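/- arXiv:2310.12519 — 6 statements merged into one kernel-verified Lean document; each statement's English description precedes it below -/
import Mathlib

section
/- Let p be a prime and let r ≥ 1 and t ≥ 0 be integers with 2t ≤ r. In the lattice ℤ², the number f(p^t, p^{r−t}) of sublattices Λ with ℤ²/Λ ≅ (ℤ/p^tℤ) × (ℤ/p^{r−t}ℤ) equals p^{r−2t} + p^{r−2t−1} if 2t < r, and equals 1 if 2t = r. -/
/-- The sublattice of vectors `w` with `M ∣ w i` and `N ∣ w j - a * w i`. -/
def latL (M N : ℕ) (i j : Fin 2) (a : ℤ) : Submodule ℤ (Fin 2 → ℤ) where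
  carrier := {w | (M : ℤ) ∣ w i ∧ (N : ℤ) ∣ w j - a * w i}
  add_mem' := by
    rintro v w ⟨h1, h2⟩ ⟨h3, h4⟩
    refine ⟨dvd_add h1 h3, ?_⟩
    have e : (v + w) j - a * (v + w) i = (v j - a * v i) + (w j - a * w i) := by
      simp only [Pi.add_apply]
      ring
    rw [e]
    exact dvd_add h2 h4
  zero_mem' := by simp
  smul_mem' := by
    rintro c w ⟨h1, h2⟩
    refine ⟨?_, ?_⟩
    · simpa using Dvd.dvd.mul_left h1 c
    · have e : (c • w) j - a * (c • w) i = c * (w j - a * w i) := by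
        simp only [Pi.smul_apply, smul_eq_mul]
        ring
      rw [e]
      exact Dvd.dvd.mul_left h2 c

theorem mem_latL (M N : ℕ) (i j : Fin 2) (a : ℤ) (w : Fin 2 → ℤ) :
    w ∈ latL M N i j a ↔ (M : ℤ) ∣ w i ∧ (N : ℤ) ∣ w j - a * w i := Iff.rfl

theorem latL_equiv (M N : ℕ) (i j : Fin 2) (hij : i ≠ j) (a : ℤ) :
    Nonempty (((Fin 2 → ℤ) ⧸ latL M N i j a) ≃+ (ZMod M × ZMod N)) := by
  let g : (Fin 2 → ℤ) →+ (ZMod M × ZMod N) :=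
    { toFun := fun w => ((w i : ZMod M), ((w j - a * w i : ℤ) : ZMod N))
      map_zero' := by simp
      map_add' := by
        intro v w
        ext
        · simp
        · simp
          ring }
  let f := g.toIntLinearMap
  have hf : Function.Surjective f := by
    rintro ⟨x, y⟩
    obtain ⟨x, rfl⟩ := ZMod.intCast_surjective x
    obtain ⟨y, rfl⟩ := ZMod.intCast_surjective y
    refine ⟨fun k => if k = i then x else y + a * x, ?_⟩
    change (((_ : ℤ) : ZMod M), ((_ : ℤ) : ZMod N)) = _
    simp [hij.symm]
  have hk : latL M N i j a = LinearMap.ker f := by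
    ext w
    rw [mem_latL, LinearMap.mem_ker]
    change _ ↔ (((_ : ℤ) : ZMod M), ((_ : ℤ) : ZMod N)) = _
    rw [Prod.mk_eq_zero, ZMod.intCast_zmod_eq_zero_iff_dvd, ZMod.intCast_zmod_eq_zero_iff_dvd]
  rw [hk]
  exact ⟨(f.quotKerEquivOfSurjective hf).toAddEquiv⟩

theorem ker_eq_latL (M N : ℕ) (hMN : M ∣ N) (i j : Fin 2) (hij : i ≠ j)
    (f : (Fin 2 → ℤ) →ₗ[ℤ] (ZMod M × ZMod N)) (hf : Function.Surjective f)
    (hu : IsUnit (f (Pi.single j 1)).2) :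
    ∃ a : ℤ, LinearMap.ker f = latL M N i j a ∧
      (f (Pi.single i 1)).2 + (a : ZMod N) * (f (Pi.single j 1)).2 = 0 := by
  obtain ⟨u, hu⟩ := hu
  obtain ⟨a, ha⟩ := ZMod.intCast_surjective (-(f (Pi.single i 1)).2 * (↑u⁻¹ : ZMod N))
  have h0 : (f (Pi.single i 1)).2 + (a : ZMod N) * (f (Pi.single j 1)).2 = 0 := by
    rw [ha, ← hu, mul_assoc]; simp
  refine ⟨a, ?_, h0⟩
  have hw : ∀ w : Fin 2 → ℤ, f w = w i • f (Pi.single i 1) + w j • f (Pi.single j 1) := by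
    intro w
    rw [← map_smul, ← map_smul, ← map_add]
    congr 1
    ext k
    have : k = i ∨ k = j := by omega
    rcases this with rfl | rfl <;> simp [hij, hij.symm]
  have hw2 : ∀ w : Fin 2 → ℤ, (f w).2 = ((w j - a * w i : ℤ) : ZMod N) * u := by
    intro w
    rw [hw w]
    simp only [Prod.snd_add, Prod.smul_snd, ← hu] at h0 ⊢
    simp only [zsmul_eq_mul]
    push_cast
    linear_combination (w i : ZMod N) * h0
  have hw2' : ∀ w : Fin 2 → ℤ, (f w).2 = 0 ↔ (N : ℤ) ∣ w j - a * w i := by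
    intro w
    rw [hw2, Units.mul_left_eq_zero, ZMod.intCast_zmod_eq_zero_iff_dvd]
  set c : ZMod M := (f (Pi.single i 1)).1 + a * (f (Pi.single j 1)).1 with hc
  have hw1 : ∀ w : Fin 2 → ℤ, (N : ℤ) ∣ w j - a * w i → (f w).1 = (w i : ZMod M) * c := by
    intro w h
    have h' : ((w j - a * w i : ℤ) : ZMod M) = 0 := by
      rw [ZMod.intCast_zmod_eq_zero_iff_dvd]
      exact (Int.natCast_dvd_natCast.2 hMN).trans h
    rw [hw w, hc]
    simp only [Prod.fst_add, Prod.smul_fst]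
    simp only [zsmul_eq_mul]
    push_cast at h'
    linear_combination (f (Pi.single j 1)).1 * h'
  obtain ⟨v, hv⟩ := hf (1, 0)
  have hcu : (v i : ZMod M) * c = 1 := by
    rw [← hw1 v ((hw2' v).1 (by rw [hv])), hv]
  have hcu' : IsUnit c := IsUnit.of_mul_eq_one_right _ hcu
  ext w
  rw [mem_latL, LinearMap.mem_ker, Prod.ext_iff]
  change (f w).1 = 0 ∧ (f w).2 = 0 ↔ _
  rw [hw2']
  refine and_congr_left fun h => ?_
  rw [hw1 w h, hcu'.mul_left_eq_zero, ZMod.intCast_zmod_eq_zero_iff_dvd]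

theorem latL_classify (p : ℕ) (hp : p.Prime) (t s : ℕ) (h1 : 1 ≤ t + s)
    (Λ : Submodule ℤ (Fin 2 → ℤ))
    (h : Nonempty (((Fin 2 → ℤ) ⧸ Λ) ≃+ (ZMod (p ^ t) × ZMod (p ^ (t + s))))) :
    (∃ a : ℤ, Λ = latL (p ^ t) (p ^ (t + s)) 0 1 a) ∨
    (∃ b : ℤ, Λ = latL (p ^ t) (p ^ (t + s)) 1 0 (p * b)) := by
  obtain ⟨e⟩ := h
  have hMN : p ^ t ∣ p ^ (t + s) := pow_dvd_pow _ (by omega)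
  let f : (Fin 2 → ℤ) →ₗ[ℤ] (ZMod (p ^ t) × ZMod (p ^ (t + s))) :=
    e.toAddMonoidHom.toIntLinearMap ∘ₗ Λ.mkQ
  have hf : Function.Surjective f := e.surjective.comp Λ.mkQ_surjective
  have hk : LinearMap.ker f = Λ := by
    ext w
    rw [LinearMap.mem_ker]
    change e (Λ.mkQ w) = 0 ↔ _
    rw [map_eq_zero_iff e e.injective]
    simp
  have hunit : ∀ x : ℤ, IsUnit (x : ZMod (p ^ (t + s))) ↔ ¬ (p : ℤ) ∣ x := by
    intro x
    rw [ZMod.coe_int_isUnit_iff_isCoprime, Nat.cast_pow,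
      IsCoprime.pow_left_iff (by omega : 0 < t + s),
      (Nat.prime_iff_prime_int.1 hp).irreducible.coprime_iff_not_dvd]
  rw [← hk]
  obtain ⟨x, hx⟩ := ZMod.intCast_surjective (f (Pi.single 0 1)).2
  obtain ⟨y, hy⟩ := ZMod.intCast_surjective (f (Pi.single 1 1)).2
  have hpN : (p : ℤ) ∣ ((p ^ (t + s) : ℕ) : ℤ) := by
    exact_mod_cast dvd_pow_self p (by omega)
  by_cases hyu : (p : ℤ) ∣ y
  · right
    have hxu : ¬ (p : ℤ) ∣ x := by
      intro hxu
      obtain ⟨v, hv⟩ := hf (0, 1)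
      have h2 : ((v 0 * x + v 1 * y - 1 : ℤ) : ZMod (p ^ (t + s))) = 0 := by
        have hv' : v = v 0 • (Pi.single 0 1 : Fin 2 → ℤ) + v 1 • (Pi.single 1 1 : Fin 2 → ℤ) := by
          ext k; fin_cases k <;> simp
        rw [hv', map_add, map_smul, map_smul] at hv
        have := congrArg Prod.snd hv
        simp only [Prod.snd_add, Prod.smul_snd, ← hx, ← hy] at this
        simp only [zsmul_eq_mul] at this
        push_cast
        rw [this]; simp
      rw [ZMod.intCast_zmod_eq_zero_iff_dvd] at h2
      have h3 := hpN.trans h2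
      have h4 : (p : ℤ) ∣ 1 := by
        have := dvd_sub (dvd_add (hxu.mul_left (v 0)) (hyu.mul_left (v 1))) h3
        simpa using this
      exact (Nat.prime_iff_prime_int.1 hp).not_dvd_one h4
    obtain ⟨a, ha, ha'⟩ := ker_eq_latL _ _ hMN 1 0 (by decide) f hf
      (by rw [← hx]; exact (hunit x).2 hxu)
    rw [← hx, ← hy] at ha'
    have h5 : ((y + a * x : ℤ) : ZMod (p ^ (t + s))) = 0 := by push_cast; exact ha'
    rw [ZMod.intCast_zmod_eq_zero_iff_dvd] at h5
    have h6 : (p : ℤ) ∣ a * x := (dvd_add_right hyu).1 (hpN.trans h5)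
    obtain ⟨b, rfl⟩ := ((Nat.prime_iff_prime_int.1 hp).dvd_or_dvd h6).resolve_right hxu
    exact ⟨b, ha⟩
  · left
    obtain ⟨a, ha, -⟩ := ker_eq_latL _ _ hMN 0 1 (by decide) f hf
      (by rw [← hy]; exact (hunit y).2 hyu)
    exact ⟨a, ha⟩

theorem latL_eq_of_dvd (p t s : ℕ) (i j : Fin 2) (a b : ℤ) (h : (p : ℤ) ^ s ∣ a - b) :
    latL (p ^ t) (p ^ (t + s)) i j a = latL (p ^ t) (p ^ (t + s)) i j b := by
  ext w
  rw [mem_latL, mem_latL]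
  refine and_congr_right fun hw => ?_
  have : (((p ^ (t + s) : ℕ) : ℤ)) ∣ (a - b) * w i := by
    push_cast at hw ⊢
    rw [pow_add, mul_comm]
    exact mul_dvd_mul h hw
  have e : w j - b * w i = (w j - a * w i) + (a - b) * w i := by ring
  rw [e, dvd_add_left this]

theorem dvd_of_latL_le (p : ℕ) (hp : p.Prime) (t s : ℕ) (i j : Fin 2) (hij : i ≠ j) (a b : ℤ)
    (h : latL (p ^ t) (p ^ (t + s)) i j a = latL (p ^ t) (p ^ (t + s)) i j b) :
    (p : ℤ) ^ s ∣ a - b := by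
  have hm : (fun k => if k = i then (p : ℤ) ^ t else a * p ^ t) ∈
      latL (p ^ t) (p ^ (t + s)) i j a := by
    rw [mem_latL]; simp [hij.symm]
  rw [h, mem_latL] at hm
  have h2 := hm.2
  have h0 : (p : ℤ) ^ t ≠ 0 := pow_ne_zero _ (by exact_mod_cast hp.ne_zero)
  simp only [hij.symm, if_false, if_true] at h2
  rw [← sub_mul, Nat.cast_pow, pow_add, mul_comm] at h2
  exact (mul_dvd_mul_iff_right h0).1 h2

theorem latL_ne (p : ℕ) (hp : p.Prime) (t s : ℕ) (hs : 1 ≤ s) (a b : ℤ) :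
    latL (p ^ t) (p ^ (t + s)) 0 1 a ≠ latL (p ^ t) (p ^ (t + s)) 1 0 (p * b) := by
  intro h
  have hm : (fun k => if k = 0 then (p : ℤ) ^ t else a * p ^ t) ∈
      latL (p ^ t) (p ^ (t + s)) 0 1 a := by
    rw [mem_latL]; simp
  rw [h, mem_latL] at hm
  have h2 := hm.2
  have h0 : (p : ℤ) ^ t ≠ 0 := pow_ne_zero _ (by exact_mod_cast hp.ne_zero)
  simp only [if_true, one_ne_zero, if_false] at h2
  have e : (p : ℤ) ^ t - p * b * (a * p ^ t) = (1 - p * (b * a)) * p ^ t := by ring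
  rw [e, Nat.cast_pow, pow_add, mul_comm] at h2
  have h3 := (mul_dvd_mul_iff_right h0).1 h2
  have h4 : (p : ℤ) ∣ 1 - p * (b * a) := (dvd_pow_self _ (by omega)).trans h3
  rw [dvd_sub_left (dvd_mul_right _ _)] at h4
  exact (Nat.prime_iff_prime_int.1 hp).not_dvd_one h4

theorem fin_eq_of_dvd (n : ℕ) (x y : Fin n) (h : (n : ℤ) ∣ (x : ℤ) - y) : x = y := by
  have hx := x.2
  have hy := y.2
  have := Int.eq_zero_of_abs_lt_dvd h (by rw [abs_lt]; omega)
  ext; omega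

theorem exists_fin_dvd (n : ℕ) (hn : 0 < n) (a : ℤ) : ∃ x : Fin n, (n : ℤ) ∣ a - (x : ℕ) := by
  have h1 := Int.emod_nonneg a (b := n) (by omega)
  have h2 := Int.emod_lt_of_pos a (b := n) (by omega)
  refine ⟨⟨(a % n).toNat, by omega⟩, ?_⟩
  simp only [Int.toNat_of_nonneg h1]
  exact Int.dvd_self_sub_emod

/-- Let p be prime, r ≥ 1, t ≥ 0 with 2t ≤ r. In ℤ², the number f(p^t, p^{r−t})
of sublattices Λ with ℤ²/Λ ≅ (ℤ/p^tℤ) × (ℤ/p^{r−t}ℤ) equals p^{r−2t} + p^{r−2t−1} if 2t < r,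
and equals 1 if 2t = r. -/
theorem stmt8 (p : ℕ) (hp : p.Prime) (r t : ℕ) (hr : 1 ≤ r) (ht : 2 * t ≤ r) :
    Nat.card {Λ : Submodule ℤ (Fin 2 → ℤ) //
        Nonempty (((Fin 2 → ℤ) ⧸ Λ) ≃+ (ZMod (p ^ t) × ZMod (p ^ (r - t))))} =
      if 2 * t < r then p ^ (r - 2 * t) + p ^ (r - 2 * t - 1) else 1 := by
  obtain ⟨s, rfl⟩ := Nat.exists_eq_add_of_le ht
  have e1 : 2 * t + s - t = t + s := by omega
  have e2 : 2 * t + s - 2 * t = s := by omega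
  rw [e1, e2]
  split_ifs with hs
  · obtain ⟨q, rfl⟩ : ∃ q, s = q + 1 := ⟨s - 1, by omega⟩
    rw [Nat.add_sub_cancel]
    have hpos : ∀ k, 0 < p ^ k := fun k => pow_pos hp.pos k
    have hp0 : (p : ℤ) ≠ 0 := by exact_mod_cast hp.ne_zero
    let F : Fin (p ^ (q + 1)) ⊕ Fin (p ^ q) → {Λ : Submodule ℤ (Fin 2 → ℤ) //
        Nonempty (((Fin 2 → ℤ) ⧸ Λ) ≃+ (ZMod (p ^ t) × ZMod (p ^ (t + (q + 1)))))} :=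
      Sum.elim
        (fun a => ⟨latL (p ^ t) (p ^ (t + (q + 1))) 0 1 ((a : ℕ) : ℤ),
          latL_equiv _ _ _ _ (by decide) _⟩)
        (fun b => ⟨latL (p ^ t) (p ^ (t + (q + 1))) 1 0 (p * ((b : ℕ) : ℤ)),
          latL_equiv _ _ _ _ (by decide) _⟩)
    have hF : Function.Bijective F := by
      constructor
      · rintro (a | a) (b | b) h
        · have h := dvd_of_latL_le p hp t _ 0 1 (by decide) _ _ (congrArg Subtype.val h)
          rw [fin_eq_of_dvd _ a b (by exact_mod_cast h)]
        · exact absurd (congrArg Subtype.val h) (latL_ne p hp t _ (by omega) _ _)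
        · exact absurd (congrArg Subtype.val h).symm (latL_ne p hp t _ (by omega) _ _)
        · have h := dvd_of_latL_le p hp t _ 1 0 (by decide) _ _ (congrArg Subtype.val h)
          rw [← mul_sub, pow_succ', mul_dvd_mul_iff_left hp0] at h
          rw [fin_eq_of_dvd _ a b (by exact_mod_cast h)]
      · rintro ⟨Λ, hΛ⟩
        rcases latL_classify p hp t _ (by omega) Λ hΛ with ⟨a, rfl⟩ | ⟨b, rfl⟩
        · obtain ⟨x, hx⟩ := exists_fin_dvd (p ^ (q + 1)) (hpos _) a
          exact ⟨Sum.inl x, Subtype.ext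
            (latL_eq_of_dvd p t (q + 1) 0 1 _ _ (by exact_mod_cast hx)).symm⟩
        · obtain ⟨x, hx⟩ := exists_fin_dvd (p ^ q) (hpos _) b
          refine ⟨Sum.inr x, Subtype.ext
            (latL_eq_of_dvd p t (q + 1) 1 0 _ _ ?_).symm⟩
          rw [← mul_sub, pow_succ']
          exact mul_dvd_mul_left _ (by exact_mod_cast hx)
    rw [← Nat.card_eq_of_bijective F hF]
    simp
  · obtain rfl : s = 0 := by omega
    rw [Nat.card_eq_one_iff_unique]
    have key : ∀ Λ : Submodule ℤ (Fin 2 → ℤ),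
        Nonempty (((Fin 2 → ℤ) ⧸ Λ) ≃+ (ZMod (p ^ t) × ZMod (p ^ (t + 0)))) →
        Λ = latL (p ^ t) (p ^ (t + 0)) 0 1 0 := by
      intro Λ hΛ
      rcases latL_classify p hp t 0 (by omega) Λ hΛ with ⟨a, rfl⟩ | ⟨b, rfl⟩
      · exact latL_eq_of_dvd p t 0 0 1 _ _ (by simp)
      · rw [latL_eq_of_dvd p t 0 1 0 (p * b) 0 (by simp)]
        ext w
        simp [mem_latL, and_comm]
    exact ⟨⟨fun A B => Subtype.ext ((key A.1 A.2).trans (key B.1 B.2).symm)⟩,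
      ⟨⟨latL (p ^ t) (p ^ (t + 0)) 0 1 0, latL_equiv _ _ _ _ (by decide) _⟩⟩⟩
end

section
/- Let p₁, …, p_l be distinct primes and let r₁, …, r_l ≥ 1 and t₁, …, t_l ≥ 0 be integers with 2t_k ≤ r_k for all k. Set m₁ = p₁^{t₁}⋯p_l^{t_l} and m₂ = p₁^{r₁−t₁}⋯p_l^{r_l−t_l}. Then in the lattice ℤ², f(m₁, m₂) = ∏_{k : 2t_k ≠ r_k} (p_k^{r_k−2t_k} + p_k^{r_k−2t_k−1}). -/
/-- Primitive pairs. -/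
def PP (R : Type*) [CommRing R] := {x : R × R // IsCoprime x.1 x.2}

/-- The lattice `m * ker (a,b)`. -/
def LL (m N : ℕ) (a b : ZMod N) : Submodule ℤ (Fin 2 → ℤ) where
  carrier := {v | ∃ w : Fin 2 → ℤ, v = (m : ℤ) • w ∧ (w 0 : ZMod N) * a + (w 1 : ZMod N) * b = 0}
  zero_mem' := ⟨0, by simp⟩
  add_mem' := by
    rintro _ _ ⟨w, rfl, hw⟩ ⟨z, rfl, hz⟩
    refine ⟨w + z, by simp, ?_⟩
    simp only [Pi.add_apply, Int.cast_add]
    linear_combination hw + hz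
  smul_mem' := by
    rintro c _ ⟨w, rfl, hw⟩
    refine ⟨c • w, smul_comm _ _ _, ?_⟩
    simp only [Pi.smul_apply, smul_eq_mul, Int.cast_mul]
    linear_combination c * hw

theorem mem_LL (m N : ℕ) (a b : ZMod N) (v : Fin 2 → ℤ) :
    v ∈ LL m N a b ↔ ∃ w : Fin 2 → ℤ, v = (m : ℤ) • w ∧
      (w 0 : ZMod N) * a + (w 1 : ZMod N) * b = 0 := Iff.rfl

theorem smul_mem_LL (m N : ℕ) (hm : 0 < m) (a b : ZMod N) (w : Fin 2 → ℤ) :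
    (m : ℤ) • w ∈ LL m N a b ↔ (w 0 : ZMod N) * a + (w 1 : ZMod N) * b = 0 := by
  rw [mem_LL]
  constructor
  · rintro ⟨z, hz, h⟩
    have : w = z := smul_right_injective _ (by positivity : (m : ℤ) ≠ 0) hz
    rwa [this]
  · intro h
    exact ⟨w, rfl, h⟩

theorem LL_eq_iff (m N : ℕ) (hm : 0 < m) (a b c d : ZMod N)
    (h1 : IsCoprime a b) (h2 : IsCoprime c d) :
    LL m N a b = LL m N c d ↔ ∃ u : (ZMod N)ˣ, c = u * a ∧ d = u * b := by
  constructor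
  · intro h
    have key : ∀ w : Fin 2 → ℤ, (w 0 : ZMod N) * a + (w 1 : ZMod N) * b = 0 →
        (w 0 : ZMod N) * c + (w 1 : ZMod N) * d = 0 := by
      intro w hw
      rw [← smul_mem_LL m N hm] at hw ⊢
      rwa [← h]
    have key2 : ∀ x y : ZMod N, x * a + y * b = 0 → x * c + y * d = 0 := by
      intro x y hxy
      obtain ⟨X, rfl⟩ := ZMod.intCast_surjective x
      obtain ⟨Y, rfl⟩ := ZMod.intCast_surjective y
      simpa using key ![X, Y] (by simpa using hxy)
    obtain ⟨x, y, hxy⟩ := h1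
    obtain ⟨z, w, hzw⟩ := h2
    have e1 := key2 (1 - a * x) (-a * y) (by linear_combination - a * hxy)
    have e2 := key2 (-b * x) (1 - b * y) (by linear_combination - b * hxy)
    have hc : c = (x * c + y * d) * a := by linear_combination e1
    have hd : d = (x * c + y * d) * b := by linear_combination e2
    have hu : IsUnit (x * c + y * d) := by
      refine IsUnit.of_mul_eq_one (z * a + w * b) ?_
      linear_combination hzw - z * hc - w * hd
    exact ⟨hu.unit, by simpa using hc, by simpa using hd⟩
  · rintro ⟨u, rfl, rfl⟩
    ext v
    simp only [mem_LL]
    refine exists_congr fun w => and_congr_right fun _ => ?_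
    rw [show (w 0 : ZMod N) * (u * a) + (w 1 : ZMod N) * (u * b) =
      u * ((w 0 : ZMod N) * a + (w 1 : ZMod N) * b) by ring]
    exact (Units.mul_right_eq_zero u).symm

theorem card_range (m N : ℕ) (hm : 0 < m) :
    Nat.card (Set.range (fun x : PP (ZMod N) => LL m N x.1.1 x.1.2)) * Nat.card (ZMod N)ˣ =
      Nat.card (PP (ZMod N)) := by
  rw [← Nat.card_prod]
  choose g hg using fun s : Set.range (fun x : PP (ZMod N) => LL m N x.1.1 x.1.2) => s.2
  refine Nat.card_congr (Equiv.ofBijective (fun q =>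
    (⟨(q.2 * (g q.1).1.1, q.2 * (g q.1).1.2), by
      have := (g q.1).2
      exact (isCoprime_mul_unit_left q.2.isUnit _ _).2 this⟩ : PP (ZMod N))) ⟨?_, ?_⟩)
  · rintro ⟨s, u⟩ ⟨s', u'⟩ h
    have h1 := congrArg (fun x => x.1.1) h
    have h2 := congrArg (fun x => x.1.2) h
    dsimp only at h1 h2
    have hs : s = s' := by
      apply Subtype.ext
      rw [← hg s, ← hg s']
      refine (LL_eq_iff m N hm _ _ _ _ (g s).2 (g s').2).2 ⟨u'⁻¹ * u, ?_, ?_⟩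
      · rw [Units.val_mul, mul_assoc, h1, Units.inv_mul_cancel_left]
      · rw [Units.val_mul, mul_assoc, h2, Units.inv_mul_cancel_left]
    subst hs
    obtain ⟨x, y, hxy⟩ := (g s).2
    have : u = u' := by
      ext
      linear_combination x * h1 + y * h2 - (u - u') * hxy
    rw [this]
  · intro x
    let s : Set.range (fun x : PP (ZMod N) => LL m N x.1.1 x.1.2) := ⟨_, x, rfl⟩
    obtain ⟨u, h1, h2⟩ := (LL_eq_iff m N hm _ _ _ _ (g s).2 x.2).1 (hg s)
    exact ⟨(s, u), Subtype.ext (Prod.ext h1.symm h2.symm)⟩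

theorem lift_coprime (N : ℕ) (hN : 0 < N) (a b : ZMod N) (h : IsCoprime a b) :
    ∃ A B : ℤ, IsCoprime A B ∧ (A : ZMod N) = a ∧ (B : ZMod N) = b := by
  have : NeZero N := ⟨hN.ne'⟩
  set B0 := b.val with hB0
  set A := a.val + N with hA
  have hAa : (A : ZMod N) = a := by simp [hA]
  have hBb : (B0 : ZMod N) = b := by simp [hB0]
  have hApos : 0 < A := by omega
  obtain ⟨B', N', hco, hB', hN'⟩ := Nat.exists_coprime B0 N
  set g := Nat.gcd B0 N with hg
  have hN'pos : 0 < N' := Nat.pos_of_ne_zero (by rintro rfl; simp at hN'; omega)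
  have : NeZero (N' * A) := ⟨by positivity⟩
  have : NeZero N' := ⟨hN'pos.ne'⟩
  obtain ⟨u, hu⟩ := ZMod.unitsMap_surjective (Dvd.intro A rfl : N' ∣ N' * A)
    (ZMod.unitOfCoprime B' hco)
  have hu' := congrArg Units.val hu
  rw [ZMod.unitsMap_val, ZMod.coe_unitOfCoprime] at hu'
  set k := (u : ZMod (N' * A)).val with hk
  have hkco : Nat.Coprime k (N' * A) := ZMod.val_coe_unit_coprime u
  have hkB : (k : ZMod N') = B' := by
    rw [← hu', hk, ZMod.natCast_val]
  have hAg : Nat.Coprime A g := by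
    set d := Nat.gcd A g with hd
    have hdA : d ∣ A := Nat.gcd_dvd_left _ _
    have hdg : d ∣ g := Nat.gcd_dvd_right _ _
    have hdB : d ∣ B0 := hdg.trans (Nat.gcd_dvd_left _ _)
    have hdN : d ∣ N := hdg.trans (Nat.gcd_dvd_right _ _)
    have h' := h.map (ZMod.castHom hdN (ZMod d))
    rw [← hAa, ← hBb, map_natCast, map_natCast, (ZMod.natCast_eq_zero_iff _ _).2 hdA,
      (ZMod.natCast_eq_zero_iff _ _).2 hdB] at h'
    obtain ⟨x, y, hxy⟩ := h'
    have h1 : ((1 : ℕ) : ZMod d) = 0 := by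
      rw [Nat.cast_one, ← hxy]; ring
    exact Nat.dvd_one.1 ((ZMod.natCast_eq_zero_iff _ _).1 h1)
  refine ⟨A, (k * g : ℕ), ?_, by simpa using hAa, ?_⟩
  · rw [Nat.isCoprime_iff_coprime]
    exact Nat.Coprime.mul_right (Nat.Coprime.coprime_mul_left_right hkco).symm hAg
  · rw [← hBb, Int.cast_natCast, hB', ZMod.natCast_eq_natCast_iff]
    rw [ZMod.natCast_eq_natCast_iff] at hkB
    have := hkB.mul_right' g
    rwa [← hN'] at this

theorem LL_quot (m N : ℕ) (hm : 0 < m) (hN : 0 < N) (a b : ZMod N) (h : IsCoprime a b) :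
    Nonempty (((Fin 2 → ℤ) ⧸ LL m N a b) ≃+ (ZMod m × ZMod (m * N))) := by
  obtain ⟨A, B, ⟨u, v, huv⟩, rfl, rfl⟩ := lift_coprime N hN a b h
  let φ : (Fin 2 → ℤ) →ₗ[ℤ] (ZMod m × ZMod (m * N)) := AddMonoidHom.toIntLinearMap
    { toFun := fun w => (((-v * w 0 + u * w 1 : ℤ) : ZMod m), ((A * w 0 + B * w 1 : ℤ) : ZMod (m * N)))
      map_zero' := by simp
      map_add' := by
        intro x y
        ext
        · simp; ring
        · simp; ring }
  have hφ : ∀ w, φ w = (((-v * w 0 + u * w 1 : ℤ) : ZMod m), ((A * w 0 + B * w 1 : ℤ) : ZMod (m * N))) :=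
    fun _ => rfl
  have hs : Function.Surjective φ := by
    rintro ⟨α, β⟩
    obtain ⟨α, rfl⟩ := ZMod.intCast_surjective α
    obtain ⟨β, rfl⟩ := ZMod.intCast_surjective β
    refine ⟨![-(B * α) + u * β, A * α + v * β], ?_⟩
    rw [hφ]
    simp only [Matrix.cons_val_zero, Matrix.cons_val_one]
    congr 2
    · linear_combination α * huv
    · linear_combination β * huv
  have hk : LinearMap.ker φ = LL m N A B := by
    ext w
    rw [LinearMap.mem_ker, hφ, mem_LL, Prod.mk_eq_zero, ZMod.intCast_zmod_eq_zero_iff_dvd,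
      ZMod.intCast_zmod_eq_zero_iff_dvd]
    have hm' : (m : ℤ) ≠ 0 := by positivity
    constructor
    · rintro ⟨⟨x, hx⟩, ⟨y, hy⟩⟩
      push_cast at hy
      have h0 : w 0 = m * (-(B * x) + u * (N * y)) := by
        linear_combination (-B) * hx + u * hy - w 0 * huv
      have h1 : w 1 = m * (A * x + v * (N * y)) := by
        linear_combination A * hx + v * hy - w 1 * huv
      refine ⟨![-(B * x) + u * (N * y), A * x + v * (N * y)], ?_, ?_⟩
      · ext i
        fin_cases i
        · simpa using h0
        · simpa using h1
      · have : ((( -(B * x) + u * (N * y)) * A + (A * x + v * (N * y)) * B : ℤ) : ZMod N) = 0 := by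
          rw [ZMod.intCast_zmod_eq_zero_iff_dvd]
          exact ⟨y, by linear_combination N * y * huv⟩
        simpa using this
    · rintro ⟨z, rfl, hz⟩
      have hz' : ((z 0 * A + z 1 * B : ℤ) : ZMod N) = 0 := by simpa using hz
      rw [ZMod.intCast_zmod_eq_zero_iff_dvd] at hz'
      obtain ⟨k, hk⟩ := hz'
      refine ⟨⟨-v * z 0 + u * z 1, ?_⟩, ⟨k, ?_⟩⟩
      · simp; ring
      · simp
        linear_combination m * hk
  exact ⟨((Submodule.quotEquivOfEq _ _ hk.symm).trans
    (φ.quotKerEquivOfSurjective hs)).toAddEquiv⟩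

theorem quot_LL (m N : ℕ) (hm : 0 < m) (hN : 0 < N) (Λ : Submodule ℤ (Fin 2 → ℤ))
    (e : ((Fin 2 → ℤ) ⧸ Λ) ≃+ (ZMod m × ZMod (m * N))) :
    ∃ a b : ZMod N, IsCoprime a b ∧ LL m N a b = Λ := by
  let φ : (Fin 2 → ℤ) →+ (ZMod m × ZMod (m * N)) := 
    e.toAddMonoidHom.comp Λ.mkQ.toAddMonoidHom
  have hφs : Function.Surjective φ := e.surjective.comp Λ.mkQ_surjective
  have hφ0 : ∀ w, φ w = 0 ↔ w ∈ Λ := by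
    intro w
    change e (Λ.mkQ w) = 0 ↔ _
    simp
  obtain ⟨⟨c, a⟩, hca⟩ : ∃ x, x = φ (Pi.single 0 1) := ⟨_, rfl⟩
  obtain ⟨⟨d, b⟩, hdb⟩ : ∃ x, x = φ (Pi.single 1 1) := ⟨_, rfl⟩
  have hφ : ∀ w, φ w = (w 0 * c + w 1 * d, w 0 * a + w 1 * b) := by
    intro w
    have : w = w 0 • Pi.single 0 1 + w 1 • Pi.single 1 1 := by
      ext i; fin_cases i <;> simp
    conv_lhs => rw [this]
    rw [map_add, map_zsmul, map_zsmul, ← hca, ← hdb]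
    simp
  have hdvd : m ∣ m * N := ⟨N, rfl⟩
  have hdvd' : N ∣ m * N := ⟨m, mul_comm _ _⟩
  let π := ZMod.castHom hdvd (ZMod m)
  let ρ := ZMod.castHom hdvd' (ZMod N)
  have : NeZero m := ⟨hm.ne'⟩
  let g : ZMod m × ZMod m → ZMod m × ZMod m := fun x =>
    (x.1 * c + x.2 * d, x.1 * π a + x.2 * π b)
  have hg : Function.Surjective g := by
    rintro ⟨x, y⟩
    obtain ⟨y, rfl⟩ := ZMod.castHom_surjective hdvd y
    obtain ⟨w, hw⟩ := hφs (x, y)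
    rw [hφ, Prod.mk.injEq] at hw
    refine ⟨(w 0, w 1), ?_⟩
    ext
    · exact hw.1
    · have := congrArg π hw.2
      simp only [map_add, map_mul, map_intCast] at this
      exact this
  have hgi : Function.Injective g := Finite.injective_iff_surjective.2 hg
  have hdiv : ∀ w ∈ Λ, ∃ z : Fin 2 → ℤ, w = (m : ℤ) • z := by
    intro w hw
    rw [← hφ0, hφ, Prod.mk_eq_zero] at hw
    have : ((w 0 : ZMod m), (w 1 : ZMod m)) = (0, 0) := by
      apply hgi
      ext
      · simpa [g] using hw.1
      · have := congrArg π hw.2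
        simpa [g] using this
    rw [Prod.mk.injEq, ZMod.intCast_zmod_eq_zero_iff_dvd, ZMod.intCast_zmod_eq_zero_iff_dvd] at this
    obtain ⟨⟨x, hx⟩, ⟨y, hy⟩⟩ := this
    refine ⟨![x, y], ?_⟩
    ext i
    fin_cases i
    · simpa using hx
    · simpa using hy
  have hco : IsCoprime a b := by
    obtain ⟨w, hw⟩ := hφs (0, 1)
    rw [hφ, Prod.mk.injEq] at hw
    exact ⟨_, _, hw.2⟩
  refine ⟨ρ a, ρ b, hco.map ρ, ?_⟩
  have hkey : ∀ z : Fin 2 → ℤ, (m : ℤ) • z ∈ Λ ↔ (z 0 : ZMod N) * ρ a + (z 1 : ZMod N) * ρ b = 0 := by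
    intro z
    rw [← hφ0, map_zsmul, hφ, Prod.smul_mk, Prod.mk_eq_zero]
    have h1 : (m : ℤ) • ((z 0 : ZMod m) * c + (z 1 : ZMod m) * d) = 0 := by simp
    obtain ⟨a', rfl⟩ := ZMod.intCast_surjective a
    obtain ⟨b', rfl⟩ := ZMod.intCast_surjective b
    simp only [h1, true_and, map_intCast]
    have h2 : (m : ℤ) • ((z 0 : ZMod (m * N)) * a' + (z 1 : ZMod (m * N)) * b') =
      ((m * (z 0 * a' + z 1 * b') : ℤ) : ZMod (m * N)) := by simp; ring
    have h3 : (z 0 : ZMod N) * a' + (z 1 : ZMod N) * b' =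
      ((z 0 * a' + z 1 * b' : ℤ) : ZMod N) := by simp
    rw [h2, h3, ZMod.intCast_zmod_eq_zero_iff_dvd, ZMod.intCast_zmod_eq_zero_iff_dvd]
    push_cast
    exact mul_dvd_mul_iff_left (by positivity)
  ext w
  constructor
  · rintro ⟨z, rfl, hz⟩
    exact (hkey z).2 hz
  · intro hw
    obtain ⟨z, rfl⟩ := hdiv w hw
    exact (smul_mem_LL m N hm _ _ z).2 ((hkey z).1 hw)

theorem PP_congr {R S : Type*} [CommRing R] [CommRing S] (e : R ≃+* S) :
    Nat.card (PP R) = Nat.card (PP S) := by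
  refine Nat.card_congr (Equiv.subtypeEquiv (e.toEquiv.prodCongr e.toEquiv) ?_)
  rintro ⟨x, y⟩
  constructor
  · intro h
    exact h.map e.toRingHom
  · intro h
    have := IsCoprime.map h e.symm.toRingHom
    simpa using this

theorem PP_pi {l : ℕ} (R : Fin l → Type) [∀ i, CommRing (R i)] :
    Nat.card (PP (∀ i, R i)) = ∏ i, Nat.card (PP (R i)) := by
  rw [← Nat.card_pi]
  refine Nat.card_congr
    { toFun := fun x i => ⟨(x.1.1 i, x.1.2 i), x.2.map (Pi.evalRingHom R i)⟩
      invFun := fun y => ⟨(fun i => (y i).1.1, fun i => (y i).1.2), ?_⟩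
      left_inv := fun x => rfl
      right_inv := fun y => rfl }
  choose a b h using fun i => (y i).2
  exact ⟨a, b, funext h⟩

theorem units_pi {l : ℕ} (R : Fin l → Type) [∀ i, CommRing (R i)] :
    Nat.card (∀ i, R i)ˣ = ∏ i, Nat.card (R i)ˣ := by
  rw [← Nat.card_pi]
  exact Nat.card_congr MulEquiv.piUnits.toEquiv

theorem coprime_iff (p e : ℕ) (hp : p.Prime) (x y : ZMod (p ^ (e + 1))) :
    IsCoprime x y ↔ IsUnit x ∨ IsUnit y := by
  constructor
  · intro h
    by_contra! hc
    have key : ∀ z : ZMod (p ^ (e + 1)), ¬ IsUnit z →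
        ZMod.castHom (dvd_pow_self p e.succ_ne_zero) (ZMod p) z = 0 := by
      intro z hz
      have : NeZero (p ^ (e + 1)) := ⟨(pow_pos hp.pos _).ne'⟩
      obtain ⟨n, rfl⟩ : ∃ n : ℕ, (n : ZMod (p ^ (e + 1))) = z := ⟨z.val, by simp⟩
      rw [map_natCast, ZMod.natCast_eq_zero_iff]
      by_contra hn
      apply hz
      rw [ZMod.isUnit_iff_coprime]
      exact Nat.Coprime.pow_right _ ((Nat.Prime.coprime_iff_not_dvd hp).2 hn).symm
    have h' := h.map (ZMod.castHom (dvd_pow_self p e.succ_ne_zero) (ZMod p))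
    rw [key x hc.1, key y hc.2] at h'
    have : Fact p.Prime := ⟨hp⟩
    obtain ⟨a, b, hab⟩ := h'
    simp at hab
  · rintro (h | h)
    · obtain ⟨u, rfl⟩ := h
      exact ⟨(u⁻¹ : (ZMod (p ^ (e + 1)))ˣ), 0, by simp⟩
    · obtain ⟨u, rfl⟩ := h
      exact ⟨0, (u⁻¹ : (ZMod (p ^ (e + 1)))ˣ), by simp⟩

open Classical in
theorem PP_prime_pow (p e : ℕ) (hp : p.Prime) :
    Nat.card (PP (ZMod (p ^ (e + 1)))) =
      Nat.card (ZMod (p ^ (e + 1)))ˣ * (p ^ (e + 1) + p ^ e) := by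
  have : NeZero (p ^ (e + 1)) := ⟨(pow_pos hp.pos _).ne'⟩
  set R := ZMod (p ^ (e + 1))
  have hcard : Fintype.card R = p ^ (e + 1) := ZMod.card _
  have hU : Nat.card Rˣ = p ^ e * (p - 1) := by
    rw [Nat.card_eq_fintype_card, ZMod.card_units_eq_totient, Nat.totient_prime_pow_succ hp]
  have hU2 : (Finset.univ.filter (fun x : R => IsUnit x)).card = p ^ e * (p - 1) := by
    rw [← hU, ← Fintype.card_subtype, ← Nat.card_eq_fintype_card]
    exact (Nat.card_congr (Equiv.ofBijective
      (fun u : Rˣ => (⟨u, u.isUnit⟩ : {x : R // IsUnit x}))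
      ⟨fun u v h => Units.ext (congrArg Subtype.val h),
        fun x => ⟨x.2.unit, rfl⟩⟩)).symm
  have h1 := Finset.card_filter_add_card_filter_not (s := (Finset.univ : Finset R))
    (fun x => IsUnit x)
  have h2 := Finset.card_filter_add_card_filter_not (s := (Finset.univ : Finset (R × R)))
    (fun x => IsCoprime x.1 x.2)
  have h3 : (Finset.univ.filter (fun x : R × R => ¬ IsCoprime x.1 x.2)) =
      (Finset.univ.filter (fun x : R => ¬ IsUnit x)) ×ˢ
      (Finset.univ.filter (fun x : R => ¬ IsUnit x)) := by
    ext x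
    simp only [Finset.mem_filter, Finset.mem_univ, true_and, Finset.mem_product]
    rw [coprime_iff p e hp]
    tauto
  have h4 : Nat.card (PP R) = (Finset.univ.filter (fun x : R × R => IsCoprime x.1 x.2)).card := by
    rw [← Fintype.card_subtype, ← Nat.card_eq_fintype_card]
    rfl
  rw [h3, Finset.card_product, ← h4, Finset.card_univ, Fintype.card_prod, hcard] at h2
  rw [hU2, Finset.card_univ, hcard] at h1
  rw [hU]
  obtain ⟨q, rfl⟩ : ∃ q, p = q + 1 := ⟨p - 1, by have := hp.pos; omega⟩
  simp only [Nat.add_sub_cancel] at h1 ⊢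
  have h5 : (Finset.univ.filter (fun x : R => ¬ IsUnit x)).card = (q + 1) ^ e := by
    have : (q + 1) ^ (e + 1) = (q + 1) ^ e * q + (q + 1) ^ e := by ring
    omega
  rw [h5] at h2
  have h6 : (q + 1) ^ (e + 1) * (q + 1) ^ (e + 1) =
      (q + 1) ^ e * q * ((q + 1) ^ (e + 1) + (q + 1) ^ e) + (q + 1) ^ e * (q + 1) ^ e := by
    ring
  rw [h6] at h2
  exact Nat.add_right_cancel h2

/-- Let p₁, …, p_l be distinct primes, r_k ≥ 1, t_k ≥ 0 with 2t_k ≤ r_k.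
Set m₁ = ∏ p_k^{t_k} and m₂ = ∏ p_k^{r_k−t_k}. Then in ℤ²,
f(m₁, m₂) = ∏_{k : 2t_k ≠ r_k} (p_k^{r_k−2t_k} + p_k^{r_k−2t_k−1}). -/
theorem stmt9 (l : ℕ) (p : Fin l → ℕ) (hp : ∀ k, (p k).Prime)
    (hinj : Function.Injective p) (r t : Fin l → ℕ)
    (hr : ∀ k, 1 ≤ r k) (ht : ∀ k, 2 * t k ≤ r k) :
    Nat.card {Λ : Submodule ℤ (Fin 2 → ℤ) //
        Nonempty (((Fin 2 → ℤ) ⧸ Λ) ≃+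
          (ZMod (∏ k, p k ^ t k) × ZMod (∏ k, p k ^ (r k - t k))))} =
      ∏ k ∈ Finset.univ.filter (fun k : Fin l => 2 * t k ≠ r k),
        (p k ^ (r k - 2 * t k) + p k ^ (r k - 2 * t k - 1)) := by
  have hpos : ∀ k, 0 < p k := fun k => (hp k).pos
  set m := ∏ k, p k ^ t k with hm
  set N := ∏ k, p k ^ (r k - 2 * t k) with hN
  have hmpos : 0 < m := Finset.prod_pos fun k _ => pow_pos (hpos k) _
  have hNpos : 0 < N := Finset.prod_pos fun k _ => pow_pos (hpos k) _
  have hmN : ∏ k, p k ^ (r k - t k) = m * N := by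
    rw [hm, hN, ← Finset.prod_mul_distrib]
    refine Finset.prod_congr rfl fun k _ => ?_
    rw [← pow_add]
    congr 1
    have := ht k
    omega
  rw [hmN]
  have hT : {Λ : Submodule ℤ (Fin 2 → ℤ) |
      Nonempty (((Fin 2 → ℤ) ⧸ Λ) ≃+ (ZMod m × ZMod (m * N)))} =
      Set.range (fun x : PP (ZMod N) => LL m N x.1.1 x.1.2) := by
    ext Λ
    constructor
    · rintro ⟨e⟩
      obtain ⟨a, b, hab, h⟩ := quot_LL m N hmpos hNpos Λ e
      exact ⟨⟨(a, b), hab⟩, h⟩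
    · rintro ⟨x, rfl⟩
      exact LL_quot m N hmpos hNpos _ _ x.2
  have hcop : Pairwise (Function.onFun Nat.Coprime (fun k => p k ^ (r k - 2 * t k))) := by
    intro i j hij
    exact Nat.Coprime.pow _ _ ((Nat.coprime_primes (hp i) (hp j)).2 (fun h => hij (hinj h)))
  have e := ZMod.prodEquivPi _ hcop
  have hcount := card_range m N hmpos
  have hUpos : 0 < Nat.card (ZMod N)ˣ := by
    have : NeZero N := ⟨hNpos.ne'⟩
    exact Nat.card_pos
  change Nat.card ({Λ : Submodule ℤ (Fin 2 → ℤ) |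
      Nonempty (((Fin 2 → ℤ) ⧸ Λ) ≃+ (ZMod m × ZMod (m * N)))} : Set _) = _
  rw [hT]
  refine Nat.eq_of_mul_eq_mul_right hUpos (hcount.trans ?_)
  rw [PP_congr e, PP_pi, Nat.card_congr (Units.mapEquiv e.toMulEquiv).toEquiv, units_pi,
    Finset.prod_filter, ← Finset.prod_mul_distrib]
  refine Finset.prod_congr rfl fun k _ => ?_
  rcases Nat.eq_zero_or_pos (r k - 2 * t k) with h0 | h0
  · rw [if_neg (by have := ht k; omega), h0, pow_zero]
    have : Unique (PP (ZMod 1)) :=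
      { default := ⟨(0, 0), ⟨0, 0, Subsingleton.elim _ _⟩⟩
        uniq := fun x => Subtype.ext (Subsingleton.elim _ _) }
    simp
  · rw [if_pos (by omega)]
    obtain ⟨e, he⟩ : ∃ e, r k - 2 * t k = e + 1 := ⟨_, (Nat.succ_pred_eq_of_pos h0).symm⟩
    rw [he, Nat.add_sub_cancel, PP_prime_pow _ _ (hp k), mul_comm]
end

section
/- Let p be a prime, let r₁, r₂, r₃ ≥ 0 be integers with r = r₁ + r₂ + r₃, and let H be the 3×3 integer matrix with rows (p^{r₁}, h₁₂, h₁₃), (0, p^{r₂}, h₂₃), (0, 0, p^{r₃}), where 0 ≤ h₁₂ < p^{r₂} and 0 ≤ h₁₃, h₂₃ < p^{r₃}. Define, with values in ℕ∞ and the convention ord_p(0) = ∞: s = min{r₁, r₂, r₃, ord_p(h₁₂), ord_p(h₁₃), ord_p(h₂₃)} and t = min{r₁+r₂, r₂+r₃, r₁+r₃, r₁+ord_p(h₂₃), r₃+ord_p(h₁₂), ord_p(h₁₂h₂₃ − p^{r₂}h₁₃)}. Then s and t are finite, and the sublattice Λ of ℤ³ spanned by the rows of H satisfies ℤ³/Λ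 ≅ (ℤ/p^sℤ) × (ℤ/p^{t−s}ℤ) × (ℤ/p^{r−t}ℤ) as abelian groups. -/
/-- ord_p(a) ∈ ℕ∞: the largest v with p^v ∣ a for a ≠ 0, and ord_p(0) = ∞. -/
noncomputable def padicOrd (p : ℕ) (a : ℤ) : ℕ∞ :=
  if a = 0 then ⊤ else ((a.natAbs.factorization p : ℕ) : ℕ∞)

open Module in
theorem snf_data (A : Matrix (Fin 3) (Fin 3) ℤ) (hA : A.det ≠ 0) :
    ∃ (a : Fin 3 → ℕ) (b : Basis (Fin 3) ℤ (Fin 3 → ℤ)),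
      (∀ x, x ∈ Submodule.span ℤ (Set.range A.row) ↔ ∀ i, (a i : ℤ) ∣ b.repr x i) ∧
      (∏ i, a i = A.det.natAbs) ∧
      Nonempty (((Fin 3 → ℤ) ⧸ Submodule.span ℤ (Set.range A.row)) ≃+ ∀ i, ZMod (a i)) := by
  have hli : LinearIndependent ℤ A.row := Matrix.linearIndependent_rows_of_det_ne_zero hA
  let bN := Basis.span hli
  have h : finrank ℤ (Submodule.span ℤ (Set.range A.row)) = finrank ℤ (Fin 3 → ℤ) := by
    rw [finrank_eq_card_basis bN]; simp
  let N := Submodule.span ℤ (Set.range A.row)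
  change finrank ℤ N = _ at h
  let b0 := Pi.basisFun ℤ (Fin 3)
  let e := N.quotientEquivPiZMod b0 h
  refine ⟨fun i => (N.smithNormalFormCoeffs b0 h i).natAbs, N.smithNormalFormTopBasis b0 h,
    ?_, ?_, ⟨e⟩⟩
  · intro x
    let a := N.smithNormalFormCoeffs b0 h
    let b' := N.smithNormalFormTopBasis b0 h
    let ab := N.smithNormalFormBotBasis b0 h
    have ab_eq := N.smithNormalFormBotBasis_def b0 h
    have key : x ∈ N ↔ ∀ i, a i ∣ b'.repr x i := by
      simp_rw [ab.mem_submodule_iff', ab, ab_eq]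
      have : ∀ (c : Fin 3 → ℤ) (i), b'.repr (∑ j, c j • a j • b' j) i = a i * c i := by
        intro c i
        simp only [← mul_smul, b'.repr_sum_self, mul_comm]
      constructor
      · rintro ⟨c, rfl⟩ i
        exact ⟨c i, this c i⟩
      · rintro ha
        choose c hc using ha
        exact ⟨c, b'.ext_elem fun i => Eq.trans (hc i) (this c i).symm⟩
    rw [key]
    simp only [Int.natAbs_dvd]
    rfl
  · have h1 := Nat.card_congr e.toEquiv
    rw [Nat.card_pi] at h1
    simp only [Nat.card_zmod] at h1
    rw [← h1]
    rw [← Submodule.natAbs_det_basis_change b0 _ bN]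
    congr 1
    have : ((↑) ∘ bN : Fin 3 → (Fin 3 → ℤ)) = A.row := by
      ext i j; simp [bN, Basis.span_apply]
    rw [this, Pi.basisFun_det_apply]
    rfl

theorem le_padicOrd_iff (p : ℕ) (hp : p.Prime) (a : ℤ) (k : ℕ) :
    (k : ℕ∞) ≤ padicOrd p a ↔ (p : ℤ) ^ k ∣ a := by
  unfold padicOrd
  split_ifs with h
  · simp [h]
  · rw [Nat.cast_le, ← hp.pow_dvd_iff_le_factorization (Int.natAbs_ne_zero.mpr h),
      ← Int.natCast_dvd]
    push_cast
    rfl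

theorem le_add_padicOrd_iff (p : ℕ) (hp : p.Prime) (a : ℤ) (k r : ℕ) :
    (k : ℕ∞) ≤ r + padicOrd p a ↔ (p : ℤ) ^ k ∣ (p : ℤ) ^ r * a := by
  have hp0 : (p : ℤ) ≠ 0 := by exact_mod_cast hp.ne_zero
  rw [← le_padicOrd_iff p hp]
  unfold padicOrd
  by_cases h : a = 0
  · simp [h]
  · have : (p : ℤ) ^ r * a ≠ 0 := mul_ne_zero (pow_ne_zero _ hp0) h
    rw [if_neg h, if_neg this, Int.natAbs_mul, Nat.factorization_mul
      (by simpa using fun h => absurd h hp.ne_zero) (by simpa using h), Int.natAbs_pow]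
    simp [hp.factorization_self]

/-- Ordering the three factors. -/
theorem final_equiv (p r s t : ℕ) (e : Fin 3 → ℕ) (hsum : ∑ i, e i = r)
    (hmin : ∀ k, (∀ i, k ≤ e i) ↔ k ≤ s) (hmax : ∀ k, (∀ i, e i ≤ k) ↔ r - k ≤ t)
    (htr : t ≤ r) :
    Nonempty ((∀ i, ZMod (p ^ e i)) ≃+
      (ZMod (p ^ s) × ZMod (p ^ (t - s)) × ZMod (p ^ (r - t)))) := by
  obtain ⟨σ, hσ⟩ : ∃ σ : Equiv.Perm (Fin 3), Monotone (e ∘ σ) := ⟨_, Tuple.monotone_sort e⟩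
  have h01 : e (σ 0) ≤ e (σ 1) := hσ (by decide)
  have h12 : e (σ 1) ≤ e (σ 2) := hσ (by decide)
  have hall : ∀ P : ℕ → Prop, (∀ i, P (e i)) ↔ P (e (σ 0)) ∧ P (e (σ 1)) ∧ P (e (σ 2)) := by
    intro P
    rw [← σ.forall_congr_right (q := fun i => P (e i))]
    simp [Fin.forall_fin_succ]
  have hs : e (σ 0) = s := by
    have h1 := (hmin s).2 le_rfl (σ 0)
    have h2 := (hmin (e (σ 0))).1 ((hall _).2 ⟨le_rfl, h01, h01.trans h12⟩)
    omega
  have hsum' : e (σ 0) + e (σ 1) + e (σ 2) = r := by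
    rw [← hsum, ← Equiv.sum_comp σ, Fin.sum_univ_three]
  have ht : e (σ 2) = r - t := by
    have h1 := (hmax (r - t)).2 (by omega) (σ 2)
    have h2 := (hmax (e (σ 2))).1 ((hall (fun z => z ≤ e (σ 2))).2 ⟨h01.trans h12, h12, le_rfl⟩)
    omega
  have hm : e (σ 1) = t - s := by omega
  rw [← hs, ← ht, hs, ← hm, ← hs]
  let f : (∀ i, ZMod (p ^ e i)) ≃+ (∀ i, ZMod (p ^ e (σ i))) :=
    (LinearEquiv.piCongrLeft ℤ (fun i => ZMod (p ^ e i)) σ).symm.toAddEquiv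
  refine ⟨f.trans ?_⟩
  exact
    { toFun := fun x => (x 0, x 1, x 2)
      invFun := fun y => Fin.cons y.1 (Fin.cons y.2.1 (Fin.cons y.2.2 finZeroElim))
      left_inv := by
        intro x
        funext i
        fin_cases i <;> rfl
      right_inv := by
        intro y
        rfl
      map_add' := by
        intro x y
        rfl }

theorem span_le_pow_iff (A : Matrix (Fin 3) (Fin 3) ℤ) (a : Fin 3 → ℕ)
    (b : Module.Basis (Fin 3) ℤ (Fin 3 → ℤ))
    (h : ∀ x, x ∈ Submodule.span ℤ (Set.range A.row) ↔ ∀ i, (a i : ℤ) ∣ b.repr x i) (q : ℤ) :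
    (∀ i, q ∣ a i) ↔ ∀ i j, q ∣ A i j := by
  constructor
  · intro hq i j
    have h1 := (h (A.row i)).1 (Submodule.subset_span ⟨i, rfl⟩)
    have h2 : A i j = ∑ l, b.repr (A.row i) l * b l j := by
      conv_lhs => rw [← Matrix.row_apply A i j, ← b.sum_repr (A.row i)]
      simp
    rw [h2]
    exact Finset.dvd_sum fun l _ => ((hq l).trans (h1 l)).mul_right _
  · intro hq i
    have key : ∀ x ∈ Submodule.span ℤ (Set.range A.row), ∃ y, x = q • y := by
      intro x hx
      induction hx using Submodule.span_induction with
      | mem x hx =>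
        obtain ⟨l, rfl⟩ := hx
        choose c hc using hq l
        exact ⟨c, by ext j; simpa using hc j⟩
      | zero => exact ⟨0, by simp⟩
      | add x y _ _ hx hy =>
        obtain ⟨u, rfl⟩ := hx
        obtain ⟨v, rfl⟩ := hy
        exact ⟨u + v, by simp⟩
      | smul c x _ hx =>
        obtain ⟨u, rfl⟩ := hx
        exact ⟨c • u, by rw [smul_comm]⟩
    obtain ⟨y, hy⟩ := key ((a i : ℤ) • b i) (by
      rw [h]
      intro l
      rw [map_smul, Finsupp.smul_apply, smul_eq_mul, Module.Basis.repr_self, Finsupp.single_apply]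
      split_ifs with hil
      · simp [hil]
      · simp)
    have := congrArg (fun z => b.repr z i) hy
    simp only [map_smul, Finsupp.smul_apply, Module.Basis.repr_self, Finsupp.single_eq_same,
      smul_eq_mul, mul_one] at this
    exact ⟨_, this⟩

theorem pow_le_span_iff (A : Matrix (Fin 3) (Fin 3) ℤ) (hA : A.det ≠ 0) (a : Fin 3 → ℕ)
    (b : Module.Basis (Fin 3) ℤ (Fin 3 → ℤ))
    (h : ∀ x, x ∈ Submodule.span ℤ (Set.range A.row) ↔ ∀ i, (a i : ℤ) ∣ b.repr x i) (q : ℤ) :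
    (∀ i, (a i : ℤ) ∣ q) ↔ ∀ i j, A.det ∣ q * A.adjugate i j := by
  have hmem : ∀ x, x ∈ Submodule.span ℤ (Set.range A.row) ↔ ∃ c, Matrix.vecMul c A = x := by
    intro x
    rw [← range_vecMulLinear]
    rfl
  have h1 : (∀ i, (a i : ℤ) ∣ q) ↔ ∀ x, q • x ∈ Submodule.span ℤ (Set.range A.row) := by
    constructor
    · intro hq x
      rw [h]
      intro i
      rw [map_smul, Finsupp.smul_apply, smul_eq_mul]
      exact (hq i).mul_right _
    · intro hq i
      have := (h _).1 (hq (b i)) i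
      rw [map_smul, Finsupp.smul_apply, smul_eq_mul, Module.Basis.repr_self,
        Finsupp.single_eq_same, mul_one] at this
      exact this
  rw [h1]
  constructor
  · intro hq i j
    obtain ⟨c, hc⟩ := (hmem _).1 (hq (Pi.single i 1))
    have := congrArg (fun z => Matrix.vecMul z A.adjugate j) hc
    simp only [Matrix.vecMul_vecMul, Matrix.mul_adjugate, Matrix.smul_vecMul,
      Matrix.vecMul_smul, Matrix.vecMul_one, Matrix.single_one_vecMul, Pi.smul_apply,
      smul_eq_mul, Matrix.row_apply] at this
    exact ⟨c j, this.symm⟩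
  · intro hq x
    choose C hC using hq
    rw [hmem]
    refine ⟨Matrix.vecMul x (Matrix.of C), ?_⟩
    have h2 : A.det • Matrix.of C = q • A.adjugate := by
      ext i j
      simpa using (hC i j).symm
    have h3 : A.det • Matrix.vecMul (Matrix.vecMul x (Matrix.of C)) A = A.det • (q • x) := by
      rw [Matrix.vecMul_vecMul, ← Matrix.vecMul_smul, ← Matrix.smul_mul, h2, Matrix.smul_mul,
        Matrix.adjugate_mul, Matrix.vecMul_smul, Matrix.vecMul_smul, Matrix.vecMul_one, smul_comm]
    exact smul_right_injective _ hA h3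

/-- the Smith normal form of a 3×3 Hermite normal form matrix with
p-power diagonal. -/
theorem stmt10 (p : ℕ) (hp : p.Prime) (r₁ r₂ r₃ : ℕ) (h₁₂ h₁₃ h₂₃ : ℤ)
    (hb₁₂ : 0 ≤ h₁₂ ∧ h₁₂ < (p : ℤ) ^ r₂)
    (hb₁₃ : 0 ≤ h₁₃ ∧ h₁₃ < (p : ℤ) ^ r₃)
    (hb₂₃ : 0 ≤ h₂₃ ∧ h₂₃ < (p : ℤ) ^ r₃)
    (s t : ℕ∞)
    (hs : s = min (min (min ((r₁ : ℕ∞)) ((r₂ : ℕ∞))) (min ((r₃ : ℕ∞)) (padicOrd p h₁₂)))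
      (min (padicOrd p h₁₃) (padicOrd p h₂₃)))
    (ht : t = min (min (min (((r₁ + r₂ : ℕ) : ℕ∞)) (((r₂ + r₃ : ℕ) : ℕ∞)))
        (min (((r₁ + r₃ : ℕ) : ℕ∞)) ((r₁ : ℕ∞) + padicOrd p h₂₃)))
      (min ((r₃ : ℕ∞) + padicOrd p h₁₂)
        (padicOrd p (h₁₂ * h₂₃ - (p : ℤ) ^ r₂ * h₁₃)))) :
    ∃ s' t' : ℕ, s = (s' : ℕ∞) ∧ t = (t' : ℕ∞) ∧
      Nonempty (((Fin 3 → ℤ) ⧸ Submodule.span ℤ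
          ({![(p : ℤ) ^ r₁, h₁₂, h₁₃], ![0, (p : ℤ) ^ r₂, h₂₃], ![0, 0, (p : ℤ) ^ r₃]} :
            Set (Fin 3 → ℤ))) ≃+
        (ZMod (p ^ s') × ZMod (p ^ (t' - s')) × ZMod (p ^ ((r₁ + r₂ + r₃) - t')))) := by
  have hp0 : (p : ℤ) ≠ 0 := by exact_mod_cast hp.ne_zero
  have hsfin : s ≠ ⊤ := by
    rintro rfl
    have : (⊤ : ℕ∞) ≤ r₁ := by
      rw [hs]; exact (min_le_left _ _).trans ((min_le_left _ _).trans (min_le_left _ _))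
    simp at this
  have htle : t ≤ ((r₁ + r₂ : ℕ) : ℕ∞) := by
    rw [ht]; exact (min_le_left _ _).trans ((min_le_left _ _).trans (min_le_left _ _))
  have htfin : t ≠ ⊤ := by
    rintro rfl
    exact absurd htle (by simp only [top_le_iff]; exact ENat.natCast_ne_top _)
  obtain ⟨s', rfl⟩ := ENat.ne_top_iff_exists.1 hsfin
  obtain ⟨t', rfl⟩ := ENat.ne_top_iff_exists.1 htfin
  refine ⟨s', t', rfl, rfl, ?_⟩
  have htle' : t' ≤ r₁ + r₂ := by exact_mod_cast htle
  let A : Matrix (Fin 3) (Fin 3) ℤ :=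
    !![(p : ℤ) ^ r₁, h₁₂, h₁₃; 0, (p : ℤ) ^ r₂, h₂₃; 0, 0, (p : ℤ) ^ r₃]
  have hdet : A.det = (p : ℤ) ^ (r₁ + r₂ + r₃) := by
    simp [A, Matrix.det_fin_three, pow_add]
  have hA : A.det ≠ 0 := by rw [hdet]; exact pow_ne_zero _ hp0
  have hrange : ({![(p : ℤ) ^ r₁, h₁₂, h₁₃], ![0, (p : ℤ) ^ r₂, h₂₃], ![0, 0, (p : ℤ) ^ r₃]} :
            Set (Fin 3 → ℤ)) = Set.range A.row := by
    ext x
    simp only [Set.mem_insert_iff, Set.mem_singleton_iff, Set.mem_range, Fin.exists_fin_succ,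
      IsEmpty.exists_iff, or_false, @eq_comm _ x]
    rfl
  rw [hrange]
  obtain ⟨a, b, hmem, hprod, ⟨e0⟩⟩ := snf_data A hA
  have hprod' : ∏ i, a i = p ^ (r₁ + r₂ + r₃) := by
    rw [hprod, hdet, Int.natAbs_pow, Int.natAbs_natCast]
  have hpow : ∀ i, ∃ k, a i = p ^ k := by
    intro i
    obtain ⟨k, -, hk⟩ := (Nat.dvd_prime_pow hp).1
      (hprod' ▸ Finset.dvd_prod_of_mem a (Finset.mem_univ i))
    exact ⟨k, hk⟩
  choose e he using hpow
  obtain rfl : a = fun i => p ^ e i := funext he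
  have hsum : ∑ i, e i = r₁ + r₂ + r₃ := by
    rw [Finset.prod_pow_eq_pow_sum] at hprod'
    exact Nat.pow_right_injective hp.two_le hprod'
  have hpd : ∀ k l : ℕ, ((p : ℤ) ^ k ∣ (p : ℤ) ^ l) ↔ k ≤ l := by
    intro k l
    rw [← Nat.cast_pow, ← Nat.cast_pow, Int.natCast_dvd_natCast,
      Nat.pow_dvd_pow_iff_le_right hp.one_lt]
  have hmin : ∀ k, (∀ i, k ≤ e i) ↔ k ≤ s' := by
    intro k
    have h1 := span_le_pow_iff A _ b hmem ((p : ℤ) ^ k)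
    simp only [Nat.cast_pow, hpd] at h1
    rw [h1, ← Nat.cast_le (α := ℕ∞), hs]
    simp only [le_min_iff, le_padicOrd_iff p hp, Nat.cast_le, A, Fin.forall_fin_succ,
      IsEmpty.forall_iff, and_true]
    simp [hpd]
    tauto
  have hmax : ∀ k, (∀ i, e i ≤ k) ↔ (r₁ + r₂ + r₃) - k ≤ t' := by
    intro k
    have h1 := pow_le_span_iff A hA _ b hmem ((p : ℤ) ^ k)
    simp only [Nat.cast_pow, hpd] at h1
    have h2 : ∀ (R : ℕ) (x : ℤ), (p : ℤ) ^ R ∣ (p : ℤ) ^ k * x ↔ (p : ℤ) ^ (R - k) ∣ x := by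
      intro R x
      rw [← le_add_padicOrd_iff p hp, ← le_padicOrd_iff p hp]
      cases padicOrd p x with
      | top => simp
      | coe n => norm_cast; omega
    rw [h1, hdet]
    simp only [h2]
    rw [← Nat.cast_le (α := ℕ∞), ht]
    simp only [le_min_iff, le_padicOrd_iff p hp, le_add_padicOrd_iff p hp, Nat.cast_le, A,
      Matrix.adjugate_fin_three_of, Fin.forall_fin_succ, IsEmpty.forall_iff, and_true]
    simp [← pow_add, hpd, mul_comm]
    have h3 : ∀ q : ℤ, q ∣ -(h₁₃ * (p : ℤ) ^ r₂) + h₁₂ * h₂₃ ↔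
        q ∣ h₁₂ * h₂₃ - h₁₃ * (p : ℤ) ^ r₂ := fun q => by rw [neg_add_eq_sub]
    tauto
  obtain ⟨f⟩ := final_equiv p (r₁ + r₂ + r₃) s' t' e hsum hmin hmax (by omega)
  exact ⟨e0.trans f⟩
end

section
/- Fix a prime p, integers n ≥ 2 and k ≥ 0, and a partition α ∈ P(n,k). For an integer r₁ with 0 ≤ r₁ ≤ k, a partition β ∈ P(n−1, k−r₁), and a tuple δ = (δ₁, …, δ_{n−1}) of integers with 0 ≤ δ_i ≤ β_i for all i, define η₀ = 0 and, for 1 ≤ j ≤ n−1, η_j = min({β_j − β_i + δ_i : 1 ≤ i < j} ∪ {δ_i : j ≤ i ≤ n−1}); let k₀ be the least index k' with 1 ≤ k' ≤ n−1 and r₁ < η_{k'}, setting k₀ = n if no such k' exists. Call δ admissible, written δ ∈ T(r₁, α, β), if (with β₀ = 0): α_k = β_{k−1} + η_k − η_{k−1} for all 1 ≤ k ≤ k₀−1, α_{k₀} = β_{k₀−1} + r₁ − η_{k₀−1}, and α_k = β_{k−1} for all k₀+1 ≤ k ≤ n. Define τ(β, δ) = ∏_{i : δ_i < β_i} (p^{β_i−δ_i}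 − p^{β_i−δ_i−1}). Then f_α(p) = ∑_{r₁=0}^{k} ∑_{β ∈ P(n−1, k−r₁)} f_β(p) · ∑_{δ ∈ T(r₁,α,β)} τ(β, δ). -/
/-- f_α(p): the number of ℤ-submodules Λ of ℤ^n with
ℤ^n/Λ ≅ (ℤ/p^{α₁}ℤ) × ⋯ × (ℤ/p^{α_n}ℤ) as abelian groups. -/
noncomputable def latCount (p : ℕ) {n : ℕ} (α : Fin n → ℕ) : ℕ :=
  Nat.card {Λ : Submodule ℤ (Fin n → ℤ) //
    Nonempty (((Fin n → ℤ) ⧸ Λ) ≃+ ((i : Fin n) → ZMod (p ^ α i)))}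

/-- 1-based access to a tuple, with value 0 outside the range 1..n (so e.g. β₀ = 0). -/
def idx1 {n : ℕ} (a : Fin n → ℕ) (j : ℕ) : ℕ :=
  if h : 1 ≤ j ∧ j ≤ n then a ⟨j - 1, by omega⟩ else 0

/-- η_j (1 ≤ j ≤ m, paper 1-based indexing; η₀ = 0):
η_j = min({β_j − β_i + δ_i : 1 ≤ i < j} ∪ {δ_i : j ≤ i ≤ m}). -/
noncomputable def eta {m : ℕ} (β δ : Fin m → ℕ) (j : ℕ) : ℕ :=
  if h : 1 ≤ j ∧ j ≤ m then
    sInf {x : ℕ | ∃ i : Fin m,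
      x = if (i : ℕ) + 1 < j then β ⟨j - 1, by omega⟩ - β i + δ i else δ i}
  else 0

open scoped Classical in
/-- k₀: the least k' with 1 ≤ k' ≤ m and r₁ < η_{k'}, and k₀ = m + 1 (= n) if none exists. -/
noncomputable def kZero {m : ℕ} (β δ : Fin m → ℕ) (r₁ : ℕ) : ℕ :=
  if h : ∃ k', 1 ≤ k' ∧ k' ≤ m ∧ r₁ < eta β δ k' then Nat.find h else m + 1

/-- δ ∈ T(r₁, α, β): 0 ≤ δ_i ≤ β_i and (with β₀ = η₀ = 0, written additively to avoid
truncated subtraction): α_k + η_{k−1} = β_{k−1} + η_k for 1 ≤ k ≤ k₀−1,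
α_{k₀} + η_{k₀−1} = β_{k₀−1} + r₁, and α_k = β_{k−1} for k₀+1 ≤ k ≤ n. -/
def isAdmissible {m : ℕ} (r₁ : ℕ) (α : Fin (m + 1) → ℕ) (β δ : Fin m → ℕ) : Prop :=
  (∀ i, δ i ≤ β i) ∧
  (∀ k, 1 ≤ k → k + 1 ≤ kZero β δ r₁ →
    idx1 α k + eta β δ (k - 1) = idx1 β (k - 1) + eta β δ k) ∧
  (idx1 α (kZero β δ r₁) + eta β δ (kZero β δ r₁ - 1) = idx1 β (kZero β δ r₁ - 1) + r₁) ∧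
  (∀ k, kZero β δ r₁ + 1 ≤ k → k ≤ m + 1 → idx1 α k = idx1 β (k - 1))

/-- τ(β, δ) = ∏_{i : δ_i < β_i} (p^{β_i−δ_i} − p^{β_i−δ_i−1}). -/
def tau (p : ℕ) {m : ℕ} (β δ : Fin m → ℕ) : ℕ :=
  ∏ i ∈ Finset.univ.filter (fun i : Fin m => δ i < β i),
    (p ^ (β i - δ i) - p ^ (β i - δ i - 1))

section combi

lemma eta_le {m : ℕ} {β δ : Fin m → ℕ} (hβ : Monotone β) {j : ℕ} (h1 : 1 ≤ j) (h2 : j ≤ m)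
    (i : Fin m) : eta β δ j ≤ δ i + (idx1 β j - β i) := by
  unfold eta idx1
  rw [dif_pos ⟨h1, h2⟩, dif_pos ⟨h1, h2⟩]
  apply Nat.sInf_le
  refine ⟨i, ?_⟩
  split_ifs with h
  · ring
  · have : β ⟨j - 1, by omega⟩ ≤ β i := hβ (by rw [Fin.le_def]; simp; omega)
    omega

lemma eta_ex {m : ℕ} {β δ : Fin m → ℕ} (hβ : Monotone β) {j : ℕ} (h1 : 1 ≤ j) (h2 : j ≤ m) :
    ∃ i : Fin m, eta β δ j = δ i + (idx1 β j - β i) := by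
  unfold eta idx1
  rw [dif_pos ⟨h1, h2⟩, dif_pos ⟨h1, h2⟩]
  have hne : {x : ℕ | ∃ i : Fin m,
      x = if (i : ℕ) + 1 < j then β ⟨j - 1, by omega⟩ - β i + δ i else δ i}.Nonempty :=
    ⟨_, ⟨j - 1, by omega⟩, rfl⟩
  obtain ⟨i, hi⟩ := Nat.sInf_mem hne
  refine ⟨i, ?_⟩
  rw [hi]
  split_ifs with h
  · ring
  · have : β ⟨j - 1, by omega⟩ ≤ β i := hβ (by rw [Fin.le_def]; simp; omega)
    omega

lemma idx1_mono {m : ℕ} {β : Fin m → ℕ} (hβ : Monotone β) {j k : ℕ} (h : j ≤ k) (hk : k ≤ m) :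
    idx1 β j ≤ idx1 β k := by
  unfold idx1
  split_ifs with h1 h2
  · exact hβ (by rw [Fin.le_def]; simp; omega)
  · omega
  · omega
  · omega

lemma idx1_succ {m : ℕ} (β : Fin m → ℕ) (i : Fin m) : idx1 β (i + 1) = β i := by
  unfold idx1
  rw [dif_pos ⟨by omega, by omega⟩]
  rfl

lemma idx1_zero {m : ℕ} (β : Fin m → ℕ) : idx1 β 0 = 0 := by
  simp [idx1]

lemma eta_zero {m : ℕ} (β δ : Fin m → ℕ) : eta β δ 0 = 0 := by
  simp [eta]

lemma eta_mono {m : ℕ} {β δ : Fin m → ℕ} (hβ : Monotone β) {j k : ℕ} (h : j ≤ k) (hk : k ≤ m) :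
    eta β δ j ≤ eta β δ k := by
  rcases Nat.eq_zero_or_pos j with rfl | hj
  · simp [eta_zero]
  obtain ⟨i, hi⟩ := eta_ex (δ := δ) hβ (show 1 ≤ k by omega) hk
  have := eta_le (δ := δ) hβ hj (h.trans hk) i
  have := idx1_mono hβ h hk
  omega

lemma eta_le_idx {m : ℕ} {β δ : Fin m → ℕ} (hβ : Monotone β) (hδ : ∀ i, δ i ≤ β i) (j : ℕ) :
    eta β δ j ≤ idx1 β j := by
  by_cases h : 1 ≤ j ∧ j ≤ m
  · have := eta_le (δ := δ) hβ h.1 h.2 ⟨j - 1, by omega⟩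
    have h3 := idx1_succ β ⟨j - 1, by omega⟩
    have h4 := hδ ⟨j - 1, by omega⟩
    simp only [show j - 1 + 1 = j by omega] at h3
    omega
  · simp [eta, h]

/-- truncated eta -/
noncomputable def zet {m : ℕ} (β δ : Fin m → ℕ) (r j : ℕ) : ℕ :=
  if j ≤ m then min (eta β δ j) r else r

lemma zet_mono {m : ℕ} {β δ : Fin m → ℕ} (hβ : Monotone β) (r : ℕ) : Monotone (zet β δ r) := by
  intro j k h
  unfold zet
  split_ifs with h1 h2
  · have := eta_mono (δ := δ) hβ h h2
    omega
  · omega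
  · omega
  · omega

lemma zet_le {m : ℕ} {β δ : Fin m → ℕ} (r j : ℕ) : zet β δ r j ≤ r := by
  unfold zet
  split_ifs <;> omega

lemma zet_zero {m : ℕ} (β δ : Fin m → ℕ) (r : ℕ) : zet β δ r 0 = 0 := by
  simp [zet, eta_zero]

lemma zet_le_idx {m : ℕ} {β δ : Fin m → ℕ} (hβ : Monotone β) (hδ : ∀ i, δ i ≤ β i) (r : ℕ)
    {j : ℕ} (hj : j ≤ m) : zet β δ r j ≤ idx1 β j := by
  have := eta_le_idx hβ hδ j
  simp [zet, hj]
  omega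

/-- `idx1 β - zet` is monotone -/
lemma zet_diff {m : ℕ} {β δ : Fin m → ℕ} (hβ : Monotone β) (hδ : ∀ i, δ i ≤ β i) (r : ℕ)
    {j : ℕ} (hj : j + 1 ≤ m) :
    zet β δ r (j + 1) + idx1 β j ≤ idx1 β (j + 1) + zet β δ r j := by
  rcases Nat.eq_zero_or_pos j with rfl | h0
  · have := zet_le_idx hβ hδ r hj
    simp [idx1_zero, zet_zero]
    omega
  obtain ⟨i, hi⟩ := eta_ex (δ := δ) hβ h0 (show j ≤ m by omega)
  have := eta_le (δ := δ) hβ (show 1 ≤ j + 1 by omega) hj i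
  have := idx1_mono hβ (show j ≤ j + 1 by omega) hj
  simp [zet, hj, show j ≤ m by omega]
  omega

lemma adm_iff {m : ℕ} {r : ℕ} {α : Fin (m + 1) → ℕ} {β δ : Fin m → ℕ} (hβ : Monotone β)
    (hδ : ∀ i, δ i ≤ β i) :
    isAdmissible r α β δ ↔
      ∀ k, k ≤ m → idx1 α (k + 1) + zet β δ r k = idx1 β k + zet β δ r (k + 1) := by
  have hk0 : 1 ≤ kZero β δ r ∧ kZero β δ r ≤ m + 1 ∧ (∀ k, k < kZero β δ r → eta β δ k ≤ r) ∧
      (∀ k, kZero β δ r ≤ k → k ≤ m → r < eta β δ k) := by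
    unfold kZero
    split_ifs with h
    · classical
      have hs := Nat.find_spec h
      refine ⟨hs.1, by omega, ?_, ?_⟩
      · intro k hk
        rcases Nat.eq_zero_or_pos k with rfl | h0
        · simp [eta_zero]
        by_contra hc
        exact Nat.find_min h hk ⟨h0, by omega, by omega⟩
      · intro k hk hkm
        exact hs.2.2.trans_le (eta_mono hβ hk hkm)
    · push Not at h
      refine ⟨by omega, by omega, ?_, ?_⟩
      · intro k hk
        rcases Nat.eq_zero_or_pos k with rfl | h0
        · simp [eta_zero]
        exact h k h0 (by omega)
      · intro k h1 h2
        omega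
  obtain ⟨h1, h2, h3, h4⟩ := hk0
  unfold isAdmissible
  generalize kZero β δ r = K at *
  have z1 : ∀ k, k < K → zet β δ r k = eta β δ k := by
    intro k hk
    have := h3 k hk
    simp [zet, show k ≤ m by omega]
    omega
  have z2 : ∀ k, K ≤ k → zet β δ r k = r := by
    intro k hk
    unfold zet
    split_ifs with h
    · have := h4 k hk h
      omega
    · rfl
  constructor
  · rintro ⟨-, a1, a2, a3⟩ k hk
    rcases lt_trichotomy (k + 1) K with h | h | h
    · have := a1 (k + 1) (by omega) (by omega)
      rw [z1 _ h, z1 k (by omega)]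
      simpa using this
    · subst h
      rw [z2 _ le_rfl, z1 k (by omega)]
      simpa using a2
    · rw [z2 k (by omega), z2 (k + 1) (by omega)]
      have := a3 (k + 1) (by omega) (by omega)
      simp at this
      omega
  · intro a
    refine ⟨hδ, ?_, ?_, ?_⟩
    · intro k hk hk'
      have := a (k - 1) (by omega)
      rw [show k - 1 + 1 = k by omega, z1 _ (by omega), z1 _ (by omega)] at this
      exact this
    · have := a (K - 1) (by omega)
      rw [show K - 1 + 1 = K by omega, z1 _ (by omega), z2 _ (by omega)] at this
      exact this
    · intro k hk hk'
      have := a (k - 1) (by omega)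
      rw [show k - 1 + 1 = k by omega, z2 _ (by omega), z2 _ (by omega)] at this
      omega

/-- exponent of the order -/
def EE {m : ℕ} (r : ℕ) (β δ : Fin m → ℕ) (t : ℕ) : ℕ :=
  max (t - r) (Finset.univ.sup fun i => min (β i) t - δ i)

lemma EE_ge {m : ℕ} (r : ℕ) (β δ : Fin m → ℕ) (t : ℕ) (i : Fin m) :
    min (β i) t - δ i ≤ EE r β δ t :=
  le_max_of_le_right (Finset.le_sup (f := fun i => min (β i) t - δ i) (Finset.mem_univ i))

lemma EE_ge' {m : ℕ} (r : ℕ) (β δ : Fin m → ℕ) (t : ℕ) : t - r ≤ EE r β δ t :=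
  le_max_left _ _

lemma EE_le_iff {m : ℕ} (r : ℕ) (β δ : Fin m → ℕ) (t a : ℕ) :
    EE r β δ t ≤ a ↔ t - r ≤ a ∧ ∀ i, min (β i) t - δ i ≤ a := by
  simp [EE, Finset.sup_le_iff]

lemma EE_L1 {m : ℕ} {r : ℕ} {β δ : Fin m → ℕ} (hβ : Monotone β) {t j : ℕ} (hj : j ≤ m)
    (ht : t ≤ idx1 β j) : t ≤ zet β δ r j + EE r β δ t := by
  rcases Nat.eq_zero_or_pos j with rfl | h0
  · rw [idx1_zero] at ht
    omega
  obtain ⟨i, hi⟩ := eta_ex (δ := δ) hβ h0 hj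
  have := EE_ge r β δ t i
  have := EE_ge' r β δ t
  simp only [zet, hj, if_true]
  omega

lemma EE_le_t {m : ℕ} {r : ℕ} {β δ : Fin m → ℕ} {t : ℕ} : EE r β δ t ≤ t := by
  rw [EE_le_iff]
  exact ⟨by omega, fun i => by omega⟩

lemma EE_L2 {m : ℕ} {r : ℕ} {β δ : Fin m → ℕ} (hβ : Monotone β) (hδ : ∀ i, δ i ≤ β i)
    {t j : ℕ} (hj : j ≤ m)
    (ht : idx1 β j ≤ t) : zet β δ r j + EE r β δ t ≤ t := by
  suffices EE r β δ t ≤ t - zet β δ r j by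
    have := zet_le_idx hβ hδ r hj
    omega
  rw [EE_le_iff]
  have hr := zet_le (β := β) (δ := δ) r j
  refine ⟨by omega, fun i => ?_⟩
  rcases Nat.eq_zero_or_pos j with rfl | h0
  · rw [zet_zero]
    omega
  have := eta_le (δ := δ) hβ h0 hj i
  have := hδ i
  simp only [zet, hj, if_true]
  omega

lemma EE_L3 {m : ℕ} {r : ℕ} {β δ : Fin m → ℕ} (hβ : Monotone β) (hδ : ∀ i, δ i ≤ β i)
    {t j : ℕ} (hj : j ≤ m) (ht : idx1 β j ≤ t) (_ht' : j + 1 ≤ m → t ≤ idx1 β (j + 1)) :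
    EE r β δ t ≤ max (t - zet β δ r (j + 1)) (idx1 β j - zet β δ r j) := by
  have hr := zet_le (β := β) (δ := δ) r (j + 1)
  rw [EE_le_iff]
  refine ⟨by omega, fun i => ?_⟩
  by_cases hi : (i : ℕ) + 1 ≤ j
  · apply le_max_of_le_right
    have h1 := idx1_mono hβ hi hj
    rw [idx1_succ] at h1
    have := eta_le (δ := δ) hβ (show 1 ≤ j by omega) hj i
    have := hδ i
    simp only [zet, hj, if_true]
    omega
  · apply le_max_of_le_left
    have hj1 : j + 1 ≤ m := by omega
    have h1 := idx1_mono hβ (show j + 1 ≤ i + 1 by omega) (by omega)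
    rw [idx1_succ] at h1
    have := eta_le (δ := δ) hβ (show 1 ≤ j + 1 by omega) hj1 i
    simp only [zet, hj1, if_true]
    omega

lemma EE_L4 {m : ℕ} {r : ℕ} {β δ : Fin m → ℕ} (hβ : Monotone β) 
    {t j : ℕ} (hj : j ≤ m) (ht : idx1 β j ≤ t) :
    idx1 β j - zet β δ r j ≤ EE r β δ t := by
  rcases Nat.eq_zero_or_pos j with rfl | h0
  · simp [idx1_zero]
  obtain ⟨i, hi⟩ := eta_ex (δ := δ) hβ h0 hj
  have := EE_ge r β δ t i
  have := EE_ge' r β δ t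
  simp only [zet, hj, if_true]
  omega

lemma local_step {m : ℕ} {r : ℕ} {β δ : Fin m → ℕ} (hβ : Monotone β) (hδ : ∀ i, δ i ≤ β i)
    {g k : ℕ} (hk : k ≤ m) (hg : g + zet β δ r k = idx1 β k + zet β δ r (k + 1)) (t : ℕ) :
    min g t + min (zet β δ r k) (t - EE r β δ t) =
      min (idx1 β k) t + min (zet β δ r (k + 1)) (t - EE r β δ t) := by
  have hz := zet_mono (δ := δ) hβ r (show k ≤ k + 1 by omega)
  have hE := EE_le_t (r := r) (β := β) (δ := δ) (t := t)
  have hi := zet_le_idx hβ hδ r hk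
  rcases lt_or_ge t (idx1 β k) with h | h
  · have := EE_L1 (r := r) (δ := δ) hβ hk h.le
    omega
  have l2 := EE_L2 (r := r) hβ hδ hk h
  by_cases hk' : k + 1 ≤ m ∧ idx1 β (k + 1) ≤ t
  · have := EE_L2 (r := r) hβ hδ hk'.1 hk'.2
    have := zet_diff hβ hδ r hk'.1
    omega
  · have h3 := EE_L3 (r := r) hβ hδ hk h (by intro h'; by_contra hc; exact hk' ⟨h', by omega⟩)
    have h4 := EE_L4 (r := r) (δ := δ) hβ hk h
    have h5 : t ≤ zet β δ r (k + 1) + EE r β δ t := by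
      by_cases hm : k + 1 ≤ m
      · exact EE_L1 hβ hm (by by_contra hc; exact hk' ⟨hm, by omega⟩)
      · have := EE_ge' r β δ t
        simp only [zet, hm, if_false]
        omega
    omega

lemma sum_idx {n : ℕ} (α : Fin n → ℕ) (f : ℕ → ℕ) :
    ∑ i, f (α i) = ∑ k ∈ Finset.range n, f (idx1 α (k + 1)) := by
  rw [Finset.sum_range]
  simp [idx1_succ]

lemma sum_of_adm {m : ℕ} {r : ℕ} {α : Fin (m + 1) → ℕ} {β δ : Fin m → ℕ} (hβ : Monotone β)
    (hδ : ∀ i, δ i ≤ β i)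
    (h : ∀ k, k ≤ m → idx1 α (k + 1) + zet β δ r k = idx1 β k + zet β δ r (k + 1)) (t : ℕ) :
    ∑ i, min (α i) t + EE r β δ t = t + ∑ i, min (β i) t := by
  rw [sum_idx α (fun x => min x t), sum_idx β (fun x => min x t)]
  have key : ∀ n, n ≤ m + 1 → ∑ k ∈ Finset.range n, min (idx1 α (k + 1)) t =
      ∑ k ∈ Finset.range n, min (idx1 β k) t + min (zet β δ r n) (t - EE r β δ t) := by
    intro n
    induction n with
    | zero => simp [zet_zero]
    | succ n ih =>
      intro hn
      rw [Finset.sum_range_succ, Finset.sum_range_succ, ih (by omega)]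
      have := local_step hβ hδ (show n ≤ m by omega) (h n (by omega)) t
      omega
  rw [key _ le_rfl, Finset.sum_range_succ']
  have := EE_ge' r β δ t
  have hE := EE_le_t (r := r) (β := β) (δ := δ) (t := t)
  simp [idx1_zero, zet]
  omega

lemma mono_le_of_sums {n : ℕ} {α γ : Fin n → ℕ} (hα : Monotone α) (hγ : Monotone γ)
    (h : ∀ t, ∑ i, min (α i) t = ∑ i, min (γ i) t) : α ≤ γ := by
  intro j
  by_contra hc
  push Not at hc
  have e : ∀ (a : Fin n → ℕ) t, ∑ i, min (a i) (t + 1) =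
      ∑ i, min (a i) t + ∑ i, if t < a i then 1 else 0 := by
    intro a t
    rw [← Finset.sum_add_distrib]
    refine Finset.sum_congr rfl fun i _ => ?_
    split_ifs <;> omega
  have h1 := e α (γ j)
  have h2 := e γ (γ j)
  rw [h, h] at h1
  have h3 : ∑ i, (if γ j < γ i then 1 else 0) < ∑ i, (if γ j < α i then 1 else 0) := by
    apply Finset.sum_lt_sum
    · intro i _
      by_cases hi : γ j < γ i
      · have : j ≤ i := by
          by_contra hji
          have := hγ (not_le.1 hji).le
          omega
        have := hα this
        rw [if_pos hi, if_pos (lt_of_lt_of_le hc this)]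
      · rw [if_neg hi]
        exact Nat.zero_le _
    · exact ⟨j, Finset.mem_univ _, by simp [hc]⟩
  omega

lemma mono_eq_of_sums {n : ℕ} {α γ : Fin n → ℕ} (hα : Monotone α) (hγ : Monotone γ)
    (h : ∀ t, ∑ i, min (α i) t = ∑ i, min (γ i) t) : α = γ :=
  le_antisymm (mono_le_of_sums hα hγ h) (mono_le_of_sums hγ hα fun t => (h t).symm)

lemma adm_iff_sums {m : ℕ} {r : ℕ} {α : Fin (m + 1) → ℕ} {β δ : Fin m → ℕ} (hα : Monotone α)
    (hβ : Monotone β) (hδ : ∀ i, δ i ≤ β i) :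
    isAdmissible r α β δ ↔
      ∀ t, ∑ i, min (α i) t + EE r β δ t = t + ∑ i, min (β i) t := by
  constructor
  · intro h t
    exact sum_of_adm hβ hδ ((adm_iff hβ hδ).1 h) t
  · intro h
    rw [adm_iff hβ hδ]
    let γ : Fin (m + 1) → ℕ := fun i => idx1 β i + zet β δ r (i + 1) - zet β δ r i
    have hγ : ∀ k, k ≤ m → idx1 γ (k + 1) + zet β δ r k = idx1 β k + zet β δ r (k + 1) := by
      intro k hk
      have h1 := idx1_succ γ ⟨k, by omega⟩
      simp only at h1
      rw [h1]
      have := zet_le_idx hβ hδ r hk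
      simp only [γ]
      omega
    have hm : Monotone γ := by
      rw [Fin.monotone_iff_le_succ]
      intro i
      have h1 := hγ i (by omega)
      have h2 := hγ (i + 1) (by omega)
      have e1 := idx1_succ γ i.castSucc
      have e2 := idx1_succ γ i.succ
      simp only [Fin.val_castSucc, Fin.val_succ] at e1 e2
      have h3 := zet_diff hβ hδ r (show (i : ℕ) + 1 ≤ m by omega)
      have h4 := zet_mono (δ := δ) hβ r (show (i : ℕ) + 1 ≤ i + 1 + 1 by omega)
      omega
    have : α = γ := by
      apply mono_eq_of_sums hα hm
      intro t
      have := sum_of_adm hβ hδ hγ t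
      have := h t
      omega
    rw [this]
    exact hγ

lemma sum_eq_of_adm {m : ℕ} {r : ℕ} {α : Fin (m + 1) → ℕ} {β δ : Fin m → ℕ} (hα : Monotone α)
    (hβ : Monotone β) (hδ : ∀ i, δ i ≤ β i) (h : isAdmissible r α β δ) :
    ∑ i, α i = r + ∑ i, β i := by
  rw [adm_iff_sums hα hβ hδ] at h
  have h1 := h (r + ∑ i, α i + ∑ i, β i)
  have e1 : ∀ i, min (α i) (r + ∑ i, α i + ∑ i, β i) = α i := by
    intro i
    have := Finset.single_le_sum (f := α) (fun _ _ => Nat.zero_le _) (Finset.mem_univ i)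
    omega
  have e2 : ∀ i, min (β i) (r + ∑ i, α i + ∑ i, β i) = β i := by
    intro i
    have := Finset.single_le_sum (f := β) (fun _ _ => Nat.zero_le _) (Finset.mem_univ i)
    omega
  have e3 : EE r β δ (r + ∑ i, α i + ∑ i, β i) = ∑ i, α i + ∑ i, β i := by
    apply le_antisymm
    · rw [EE_le_iff]
      refine ⟨by omega, fun i => ?_⟩
      have := Finset.single_le_sum (f := β) (fun _ _ => Nat.zero_le _) (Finset.mem_univ i)
      omega
    · have := EE_ge' r β δ (r + ∑ i, α i + ∑ i, β i)
      omega
  simp only [e1, e2, e3] at h1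
  omega

end combi

section groups

/-- index of `p^t A` in `A` -/
noncomputable def NN (p t : ℕ) (A : Type*) [AddCommGroup A] : ℕ :=
  (nsmulAddMonoidHom (α := A) (p ^ t)).range.index

lemma NN_of_surj (p t : ℕ) {M A : Type*} [AddCommGroup M] [AddCommGroup A] (f : M →+ A)
    (hf : Function.Surjective f) :
    NN p t A = ((nsmulAddMonoidHom (α := M) (p ^ t)).range ⊔ f.ker).index := by
  unfold NN
  rw [← AddSubgroup.index_comap_of_surjective _ hf]
  congr 1
  apply le_antisymm
  · rintro x ⟨a, ha⟩
    obtain ⟨y, rfl⟩ := hf a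
    have : x = p ^ t • y + (x - p ^ t • y) := by abel
    rw [this]
    refine AddSubgroup.add_mem_sup ⟨y, rfl⟩ ?_
    simp only [nsmulAddMonoidHom_apply] at ha
    rw [AddMonoidHom.mem_ker, map_sub, map_nsmul, ha, sub_self]
  · rw [sup_le_iff]
    constructor
    · rintro _ ⟨y, rfl⟩
      exact ⟨f y, by simp⟩
    · intro x hx
      exact ⟨0, by simp [AddMonoidHom.mem_ker.1 hx]⟩

lemma NN_congr (p t : ℕ) {A B : Type*} [AddCommGroup A] [AddCommGroup B] (e : A ≃+ B) :
    NN p t A = NN p t B := by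
  rw [NN_of_surj p t e.toAddMonoidHom e.surjective]
  have : e.toAddMonoidHom.ker = ⊥ := by
    rw [AddMonoidHom.ker_eq_bot_iff]
    exact e.injective
  rw [this, sup_bot_eq]
  rfl

lemma dvd_iff_range (p : ℕ) (t b : ℕ) (z : ℤ) :
    (∃ c : ZMod (p ^ b), p ^ t • c = (z : ZMod (p ^ b))) ↔ ((p ^ min b t : ℕ) : ℤ) ∣ z := by
  constructor
  · rintro ⟨c, hc⟩
    obtain ⟨c, rfl⟩ := ZMod.intCast_surjective c
    have h : (((p ^ t : ℕ) * c : ℤ) : ZMod (p ^ b)) = (z : ZMod (p ^ b)) := by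
      rw [← hc]; simp
    rw [ZMod.intCast_eq_intCast_iff_dvd_sub] at h
    have h1 : ((p ^ min b t : ℕ) : ℤ) ∣ ((p ^ b : ℕ) : ℤ) :=
      Int.natCast_dvd_natCast.2 (pow_dvd_pow _ (min_le_left _ _))
    have h2 : ((p ^ min b t : ℕ) : ℤ) ∣ ((p ^ t : ℕ) : ℤ) * c :=
      (Int.natCast_dvd_natCast.2 (pow_dvd_pow _ (min_le_right _ _))).mul_right _
    have := dvd_add (h1.trans h) h2
    simpa using this
  · rintro ⟨c, rfl⟩
    rcases le_total b t with h | h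
    · refine ⟨0, ?_⟩
      rw [min_eq_left h]
      have : ((p ^ b : ℕ) : ZMod (p ^ b)) = 0 := ZMod.natCast_self _
      push_cast at this ⊢
      simp [this]
    · refine ⟨(c : ZMod (p ^ b)), ?_⟩
      rw [min_eq_right h]
      push_cast
      simp

/-- reduction map -/
def redHom (p : ℕ) {m : ℕ} (β : Fin m → ℕ) : (Fin m → ℤ) →+ ((i : Fin m) → ZMod (p ^ β i)) where
  toFun v i := (v i : ZMod (p ^ β i))
  map_zero' := by ext; simp
  map_add' := by intros; ext; simp

lemma redHom_surj (p : ℕ) {m : ℕ} (β : Fin m → ℕ) : Function.Surjective (redHom p β) := by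
  intro y
  choose v hv using fun i => ZMod.intCast_surjective (y i)
  exact ⟨v, funext hv⟩

lemma NN_pi (p t : ℕ) {m : ℕ} (β : Fin m → ℕ) :
    NN p t ((i : Fin m) → ZMod (p ^ β i)) = p ^ (∑ i, min (β i) t) := by
  unfold NN
  rw [← AddSubgroup.index_comap_of_surjective _ (redHom_surj p β)]
  have : (nsmulAddMonoidHom (α := (i : Fin m) → ZMod (p ^ β i)) (p ^ t)).range.comap (redHom p β)
      = AddSubgroup.pi Set.univ fun i => AddSubgroup.zmultiples ((p ^ min (β i) t : ℕ) : ℤ) := by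
    ext v
    simp only [AddSubgroup.mem_comap, AddMonoidHom.mem_range, nsmulAddMonoidHom_apply,
      AddSubgroup.mem_pi, Set.mem_univ, forall_true_left, Int.mem_zmultiples_iff]
    simp only [← dvd_iff_range]
    constructor
    · rintro ⟨y, hy⟩ i
      exact ⟨y i, congrFun hy i⟩
    · intro h
      choose y hy using h
      exact ⟨y, funext hy⟩
  rw [this, AddSubgroup.index_pi]
  simp only [Int.index_zmultiples, Int.natAbs_natCast]
  rw [Finset.prod_pow_eq_pow_sum]

lemma index_sup_zmultiples {B : Type*} [AddCommGroup B] (H : AddSubgroup B) (u : B) (e : ℕ)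
    (h : ∀ z : ℤ, z • u ∈ H ↔ (e : ℤ) ∣ z) :
    e * (H ⊔ AddSubgroup.zmultiples u).index = H.index := by
  rw [← AddSubgroup.relIndex_mul_index (le_sup_left : H ≤ H ⊔ AddSubgroup.zmultiples u),
    AddSubgroup.relIndex_sup_left]
  congr 1
  have h1 : AddSubgroup.zmultiples u = (zmultiplesHom B u).range := by
    ext x
    simp [AddSubgroup.mem_zmultiples_iff]
  rw [h1, ← AddSubgroup.index_comap]
  have h2 : H.comap (zmultiplesHom B u) = AddSubgroup.zmultiples (e : ℤ) := by
    ext z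
    simp [h, Int.mem_zmultiples_iff]
  rw [h2]
  simp

/-- capped valuation -/
def dval (p : ℕ) {m : ℕ} {β : Fin m → ℕ} (y : (i : Fin m) → ZMod (p ^ β i)) (i : Fin m) : ℕ :=
  padicValNat p (Nat.gcd (p ^ β i) (y i).val)

lemma dval_spec {p : ℕ} (hp : p.Prime) {m : ℕ} {β : Fin m → ℕ}
    (y : (i : Fin m) → ZMod (p ^ β i)) (i : Fin m) :
    dval p y i ≤ β i ∧ Nat.gcd (p ^ β i) (y i).val = p ^ dval p y i := by
  obtain ⟨d, hd, he⟩ := (Nat.dvd_prime_pow hp).1 (Nat.gcd_dvd_left (p ^ β i) (y i).val)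
  have : dval p y i = d := by
    have := Fact.mk hp
    unfold dval
    rw [he, padicValNat.prime_pow]
  rw [this]
  exact ⟨hd, he⟩

lemma pow_dvd_aux {p : ℕ} (hp : p.Prime) {M b d w : ℕ} (hM : M ≤ b)
    (h : Nat.gcd (p ^ b) w = p ^ d) (hd : d ≤ b) (z : ℤ) :
    ((p ^ M : ℕ) : ℤ) ∣ z * w ↔ ((p ^ (M - d) : ℕ) : ℤ) ∣ z := by
  have hw : p ^ d ∣ w := h ▸ Nat.gcd_dvd_right _ _
  obtain ⟨c, rfl⟩ := hw
  rcases le_total M d with hMd | hMd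
  · simp only [Nat.sub_eq_zero_of_le hMd, pow_zero, Nat.cast_one, one_dvd, iff_true]
    apply Dvd.dvd.mul_left
    rw [Int.natCast_dvd_natCast]
    exact (pow_dvd_pow _ hMd).mul_right _
  rcases eq_or_lt_of_le hd with rfl | hd'
  · obtain rfl : M = d := by omega
    simp only [Nat.sub_self, pow_zero, Nat.cast_one, one_dvd, iff_true]
    apply Dvd.dvd.mul_left
    rw [Int.natCast_dvd_natCast]
    exact dvd_mul_right _ _
  have hc : ¬ p ∣ c := by
    rintro ⟨c', rfl⟩
    have : p ^ (d + 1) ∣ Nat.gcd (p ^ b) (p ^ d * (p * c')) := by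
      apply Nat.dvd_gcd (pow_dvd_pow _ hd')
      exact ⟨c', by rw [Nat.succ_eq_add_one]; ring⟩
    rw [h] at this
    have := (Nat.pow_dvd_pow_iff_le_right hp.one_lt).1 this
    omega
  have hcop : IsCoprime ((p ^ (M - d) : ℕ) : ℤ) (c : ℤ) := by
    rw [Nat.isCoprime_iff_coprime]
    exact Nat.Coprime.pow_left _ ((Nat.Prime.coprime_iff_not_dvd hp).2 hc)
  have e1 : ((p ^ M : ℕ) : ℤ) = ((p ^ d : ℕ) : ℤ) * ((p ^ (M - d) : ℕ) : ℤ) := by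
    rw [← Nat.cast_mul, ← pow_add, Nat.add_sub_cancel' hMd]
  have e2 : z * ((p ^ d * c : ℕ) : ℤ) = ((p ^ d : ℕ) : ℤ) * (z * c) := by
    push_cast; ring
  have hne : ((p ^ d : ℕ) : ℤ) ≠ 0 := by
    exact_mod_cast (pow_pos hp.pos d).ne'
  rw [e1, e2, mul_dvd_mul_iff_left hne]
  exact ⟨fun h => IsCoprime.dvd_of_dvd_mul_right hcop h, fun h => h.mul_right _⟩

lemma index_key {p : ℕ} (hp : p.Prime) {m : ℕ} {β : Fin m → ℕ} (r t : ℕ)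
    (y : (i : Fin m) → ZMod (p ^ β i)) :
    p ^ EE r β (dval p y) t *
      ((nsmulAddMonoidHom (α := ℤ × ((i : Fin m) → ZMod (p ^ β i))) (p ^ t)).range ⊔
        AddSubgroup.zmultiples (((p ^ r : ℕ) : ℤ), y)).index = p ^ (t + ∑ i, min (β i) t) := by
  have hne : ∀ i, NeZero (p ^ β i) := fun i => ⟨(pow_pos hp.pos _).ne'⟩
  rw [index_sup_zmultiples]
  · have : (nsmulAddMonoidHom (α := ℤ × ((i : Fin m) → ZMod (p ^ β i))) (p ^ t)).range =
      (AddSubgroup.zmultiples ((p ^ t : ℕ) : ℤ)).prod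
        (nsmulAddMonoidHom (α := ((i : Fin m) → ZMod (p ^ β i))) (p ^ t)).range := by
      ext ⟨a, x⟩
      simp only [AddMonoidHom.mem_range, nsmulAddMonoidHom_apply, AddSubgroup.mem_prod,
        Int.mem_zmultiples_iff]
      constructor
      · rintro ⟨⟨b, c⟩, h⟩
        simp only [Prod.smul_mk, Prod.mk.injEq] at h
        refine ⟨⟨b, ?_⟩, c, h.2⟩
        rw [← h.1]; simp
      · rintro ⟨⟨b, rfl⟩, c, rfl⟩
        exact ⟨(b, c), by simp⟩
    rw [this, AddSubgroup.index_prod, pow_add]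
    congr 1
    · simp
    · exact NN_pi p t β
  · intro z
    have h1 : z • (((p ^ r : ℕ) : ℤ), y) ∈
        (nsmulAddMonoidHom (α := ℤ × ((i : Fin m) → ZMod (p ^ β i))) (p ^ t)).range ↔
        ((p ^ t : ℕ) : ℤ) ∣ z * ((p ^ r : ℕ) : ℤ) ∧
          ∀ i, ((p ^ min (β i) t : ℕ) : ℤ) ∣ z * ((y i).val : ℤ) := by
      simp only [← dvd_iff_range]
      have e : ∀ i, ((z * ((y i).val : ℤ) : ℤ) : ZMod (p ^ β i)) = z • y i := by
        intro i
        simp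
      simp only [e]
      simp only [AddMonoidHom.mem_range, nsmulAddMonoidHom_apply]
      constructor
      · rintro ⟨⟨b, c⟩, h⟩
        simp only [Prod.smul_mk, Prod.mk.injEq] at h
        refine ⟨⟨b, ?_⟩, fun i => ⟨c i, congrFun h.2 i⟩⟩
        have := h.1
        simp at this ⊢
        exact this.symm
      · rintro ⟨⟨b, hb⟩, h⟩
        choose c hc using h
        refine ⟨(b, c), ?_⟩
        simp only [Prod.smul_mk, Prod.mk.injEq]
        refine ⟨?_, funext hc⟩
        simp at hb ⊢
        exact hb.symm
    rw [h1]
    have h2 : ((p ^ t : ℕ) : ℤ) ∣ z * ((p ^ r : ℕ) : ℤ) ↔ ((p ^ (t - r) : ℕ) : ℤ) ∣ z := by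
      apply pow_dvd_aux hp (b := max t r) (le_max_left _ _) _ (le_max_right _ _)
      exact Nat.gcd_eq_right (pow_dvd_pow _ (le_max_right _ _))
    have h3 : ∀ i, ((p ^ min (β i) t : ℕ) : ℤ) ∣ z * ((y i).val : ℤ) ↔
        ((p ^ (min (β i) t - dval p y i) : ℕ) : ℤ) ∣ z := fun i =>
      pow_dvd_aux hp (min_le_left _ _) (dval_spec hp y i).2 (dval_spec hp y i).1 z
    rw [h2]
    simp only [h3]
    constructor
    · rintro ⟨a1, a2⟩
      unfold EE
      rcases le_total (t - r) (Finset.univ.sup fun i => min (β i) t - dval p y i) with h | h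
      · rw [max_eq_right h]
        by_cases hm : (Finset.univ : Finset (Fin m)).Nonempty
        · obtain ⟨i, -, hi⟩ := Finset.exists_mem_eq_sup _ hm (fun i => min (β i) t - dval p y i)
          rw [hi]
          exact a2 i
        · rw [Finset.not_nonempty_iff_eq_empty.1 hm]
          simp
      · rw [max_eq_left h]
        exact a1
    · intro h
      refine ⟨?_, fun i => ?_⟩
      · exact (Int.natCast_dvd_natCast.2 (pow_dvd_pow _ (EE_ge' r β _ t))).trans h
      · exact (Int.natCast_dvd_natCast.2 (pow_dvd_pow _ (EE_ge r β _ t i))).trans h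

lemma exists_type {p : ℕ} (hp : p.Prime) {n : ℕ} (Λ : Submodule ℤ (Fin n → ℤ)) (K : ℕ)
    (hK : ∀ v, ((p ^ K : ℕ) : ℤ) • v ∈ Λ) :
    ∃ γ : Fin n → ℕ, Monotone γ ∧
      Nonempty (((Fin n → ℤ) ⧸ Λ) ≃+ ((i : Fin n) → ZMod (p ^ γ i))) := by
  have hfr : Module.finrank ℤ Λ = Module.finrank ℤ (Fin n → ℤ) := by
    apply le_antisymm (Submodule.finrank_le _)
    have hne : ((p ^ K : ℕ) : ℤ) ≠ 0 := by exact_mod_cast (pow_pos hp.pos K).ne'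
    let f : (Fin n → ℤ) →ₗ[ℤ] Λ :=
      LinearMap.codRestrict Λ (LinearMap.lsmul ℤ (Fin n → ℤ) ((p ^ K : ℕ) : ℤ)) hK
    apply LinearMap.finrank_le_finrank_of_injective (f := f)
    intro a b hab
    have := congrArg Subtype.val hab
    exact smul_right_injective _ hne this
  obtain ⟨c, ⟨e⟩⟩ : ∃ c : Fin n → ℕ, Nonempty (((Fin n → ℤ) ⧸ Λ) ≃+ ((i : Fin n) → ZMod (c i))) :=
    ⟨_, ⟨Submodule.quotientEquivPiZMod Λ (Pi.basisFun ℤ (Fin n)) hfr⟩⟩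
  have hc : ∀ i, ∃ b, c i = p ^ b := by
    intro i
    have h1 : ∀ x : (Fin n → ℤ) ⧸ Λ, (p ^ K) • x = 0 := by
      intro x
      obtain ⟨v, rfl⟩ := Submodule.mkQ_surjective Λ x
      rw [← map_nsmul, Submodule.mkQ_apply, Submodule.Quotient.mk_eq_zero]
      have := hK v
      rwa [natCast_zsmul] at this
    have h2 : (p ^ K) • (Pi.single i 1 : (i : Fin n) → ZMod (c i)) = 0 := by
      have := h1 (e.symm (Pi.single i 1))
      rw [← map_nsmul] at this
      simpa using this
    have h3 := congrFun h2 i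
    simp only [Pi.smul_apply, Pi.single_eq_same, Pi.zero_apply, nsmul_eq_mul, mul_one] at h3
    rw [ZMod.natCast_eq_zero_iff] at h3
    obtain ⟨b, -, hb⟩ := (Nat.dvd_prime_pow hp).1 h3
    exact ⟨b, hb⟩
  choose b hb using hc
  obtain rfl : c = fun i => p ^ b i := funext hb
  refine ⟨b ∘ Tuple.sort b, Tuple.monotone_sort b, ⟨e.trans ?_⟩⟩
  exact { (Equiv.piCongrLeft' (fun i => ZMod (p ^ b i)) (Tuple.sort b).symm) with
    map_add' := by intros; rfl }

lemma type_iff {p : ℕ} (hp : p.Prime) {n : ℕ} (Λ : Submodule ℤ (Fin n → ℤ)) (K : ℕ)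
    (hK : ∀ v, ((p ^ K : ℕ) : ℤ) • v ∈ Λ) {α : Fin n → ℕ} (hα : Monotone α) :
    Nonempty (((Fin n → ℤ) ⧸ Λ) ≃+ ((i : Fin n) → ZMod (p ^ α i))) ↔
      ∀ t, NN p t ((Fin n → ℤ) ⧸ Λ) = p ^ (∑ i, min (α i) t) := by
  constructor
  · rintro ⟨e⟩ t
    rw [NN_congr p t e, NN_pi]
  · intro h
    obtain ⟨γ, hγ, ⟨e⟩⟩ := exists_type hp Λ K hK
    have : α = γ := by
      apply mono_eq_of_sums hα hγ
      intro t
      have := h t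
      rw [NN_congr p t e, NN_pi] at this
      exact (Nat.pow_right_injective hp.two_le this).symm
    rw [this]
    exact ⟨e⟩

lemma type_unique {p : ℕ} (hp : p.Prime) {n : ℕ} {A : Type*} [AddCommGroup A] {α γ : Fin n → ℕ}
    (hα : Monotone α) (hγ : Monotone γ) (e : A ≃+ ((i : Fin n) → ZMod (p ^ α i)))
    (e' : A ≃+ ((i : Fin n) → ZMod (p ^ γ i))) : α = γ := by
  apply mono_eq_of_sums hα hγ
  intro t
  have := NN_congr p t e
  rw [NN_congr p t e', NN_pi, NN_pi] at this
  exact (Nat.pow_right_injective hp.two_le this).symm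

lemma type_bound {p : ℕ} {n : ℕ} (Λ : Submodule ℤ (Fin n → ℤ)) {α : Fin n → ℕ}
    (e : ((Fin n → ℤ) ⧸ Λ) ≃+ ((i : Fin n) → ZMod (p ^ α i))) (v : Fin n → ℤ) :
    ((p ^ (∑ i, α i) : ℕ) : ℤ) • v ∈ Λ := by
  rw [← Submodule.Quotient.mk_eq_zero, Submodule.Quotient.mk_smul]
  apply e.injective
  rw [map_zsmul, map_zero]
  ext i
  have h : p ^ α i ∣ p ^ (∑ i, α i) :=
    pow_dvd_pow _ (Finset.single_le_sum (f := α) (fun _ _ => Nat.zero_le _) (Finset.mem_univ i))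
  have h' := (ZMod.natCast_eq_zero_iff _ _).2 h
  rw [Pi.smul_apply, natCast_zsmul, nsmul_eq_mul, h', zero_mul]
  rfl

end groups

section lattices

/-- first coordinate, and the remaining coordinates modulo the sublattice -/
def phiHom {m : ℕ} (Λ' : Submodule ℤ (Fin m → ℤ)) :
    (Fin (m + 1) → ℤ) →+ ℤ × ((Fin m → ℤ) ⧸ Λ') where
  toFun v := (v 0, Submodule.Quotient.mk (Fin.tail v))
  map_zero' := rfl
  map_add' := by intros; rfl

lemma phiHom_apply {m : ℕ} (Λ' : Submodule ℤ (Fin m → ℤ)) (v : Fin (m + 1) → ℤ) :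
    phiHom Λ' v = (v 0, Submodule.Quotient.mk (Fin.tail v)) := rfl

lemma phiHom_surj {m : ℕ} (Λ' : Submodule ℤ (Fin m → ℤ)) : Function.Surjective (phiHom Λ') := by
  rintro ⟨a, x⟩
  obtain ⟨w, rfl⟩ := Submodule.Quotient.mk_surjective Λ' x
  exact ⟨Fin.cons a w, by simp [phiHom_apply]⟩

/-- lattice attached to an exponent, a sublattice and a coset -/
def lat (p r : ℕ) {m : ℕ} (Λ' : Submodule ℤ (Fin m → ℤ)) (x : (Fin m → ℤ) ⧸ Λ') :
    Submodule ℤ (Fin (m + 1) → ℤ) :=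
  AddSubgroup.toIntSubmodule
    ((AddSubgroup.zmultiples (((p ^ r : ℕ) : ℤ), x)).comap (phiHom Λ'))

lemma mem_lat {p r m : ℕ} {Λ' : Submodule ℤ (Fin m → ℤ)} {x : (Fin m → ℤ) ⧸ Λ'}
    {v : Fin (m + 1) → ℤ} :
    v ∈ lat p r Λ' x ↔ ∃ c : ℤ, c * ((p ^ r : ℕ) : ℤ) = v 0 ∧
      c • x = Submodule.Quotient.mk (Fin.tail v) := by
  have : v ∈ lat p r Λ' x ↔ phiHom Λ' v ∈ AddSubgroup.zmultiples (((p ^ r : ℕ) : ℤ), x) := Iff.rfl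
  rw [this, AddSubgroup.mem_zmultiples_iff]
  simp [phiHom_apply, Prod.ext_iff]

lemma lat_bound {p r m : ℕ} {Λ' : Submodule ℤ (Fin m → ℤ)} {β : Fin m → ℕ}
    (e : ((Fin m → ℤ) ⧸ Λ') ≃+ ((i : Fin m) → ZMod (p ^ β i))) (x : (Fin m → ℤ) ⧸ Λ')
    (v : Fin (m + 1) → ℤ) : ((p ^ (r + ∑ i, β i) : ℕ) : ℤ) • v ∈ lat p r Λ' x := by
  have h0 : ∀ y : (Fin m → ℤ) ⧸ Λ', ((p ^ (∑ i, β i) : ℕ) : ℤ) • y = 0 := by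
    intro y
    obtain ⟨w, rfl⟩ := Submodule.Quotient.mk_surjective Λ' y
    rw [← Submodule.Quotient.mk_smul, Submodule.Quotient.mk_eq_zero]
    exact type_bound Λ' e w
  rw [mem_lat]
  refine ⟨((p ^ (∑ i, β i) : ℕ) : ℤ) * v 0, ?_, ?_⟩
  · simp only [Pi.smul_apply, smul_eq_mul]
    push_cast
    ring
  · rw [mul_comm, mul_smul, h0, smul_zero]
    have : Fin.tail (((p ^ (r + ∑ i, β i) : ℕ) : ℤ) • v) =
        ((p ^ (∑ i, β i) : ℕ) : ℤ) • ((p ^ r : ℕ) : ℤ) • Fin.tail v := by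
      ext i
      simp only [Fin.tail, Pi.smul_apply, smul_eq_mul]
      push_cast
      ring
    rw [this, Submodule.Quotient.mk_smul, h0]

lemma NN_lat {p : ℕ} (hp : p.Prime) {r m : ℕ} {Λ' : Submodule ℤ (Fin m → ℤ)} {β : Fin m → ℕ}
    (e : ((Fin m → ℤ) ⧸ Λ') ≃+ ((i : Fin m) → ZMod (p ^ β i))) (x : (Fin m → ℤ) ⧸ Λ') (t : ℕ) :
    p ^ EE r β (dval p (e x)) t * NN p t ((Fin (m + 1) → ℤ) ⧸ lat p r Λ' x) =
      p ^ (t + ∑ i, min (β i) t) := by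
  rw [← index_key hp r t (e x)]
  congr 1
  rw [NN_of_surj p t (lat p r Λ' x).mkQ.toAddMonoidHom (Submodule.mkQ_surjective _)]
  let Φ : (Fin (m + 1) → ℤ) →+ ℤ × ((i : Fin m) → ZMod (p ^ β i)) :=
    (AddMonoidHom.prodMap (AddMonoidHom.id ℤ) e.toAddMonoidHom).comp (phiHom Λ')
  have hΦ : Function.Surjective Φ := by
    apply Function.Surjective.comp (g := (AddMonoidHom.prodMap (AddMonoidHom.id ℤ) e.toAddMonoidHom))
    · rintro ⟨a, y⟩
      exact ⟨(a, e.symm y), by simp⟩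
    · exact phiHom_surj Λ'
  have hker : (lat p r Λ' x).mkQ.toAddMonoidHom.ker =
      (AddSubgroup.zmultiples (((p ^ r : ℕ) : ℤ), e x)).comap Φ := by
    ext v
    have h1 : v ∈ (lat p r Λ' x).mkQ.toAddMonoidHom.ker ↔ v ∈ lat p r Λ' x :=
      Submodule.Quotient.mk_eq_zero _
    rw [h1, mem_lat, AddSubgroup.mem_comap, AddSubgroup.mem_zmultiples_iff]
    apply exists_congr
    intro c
    have h2 : Φ v = (v 0, e (Submodule.Quotient.mk (Fin.tail v))) := rfl
    rw [h2]
    simp only [Prod.smul_mk, Prod.mk.injEq, smul_eq_mul]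
    rw [← map_zsmul, e.injective.eq_iff]
  rw [hker]
  rw [← AddSubgroup.index_map_eq _ hΦ]
  · congr 1
    rw [AddSubgroup.map_sup, AddSubgroup.map_comap_eq_self_of_surjective hΦ]
    congr 1
    ext y
    constructor
    · rintro ⟨_, ⟨v, rfl⟩, rfl⟩
      exact ⟨Φ v, by simp only [nsmulAddMonoidHom_apply, map_nsmul]⟩
    · rintro ⟨y, rfl⟩
      obtain ⟨v, rfl⟩ := hΦ y
      exact ⟨_, ⟨v, rfl⟩, by simp only [nsmulAddMonoidHom_apply, map_nsmul]⟩
  · refine le_trans ?_ le_sup_right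
    intro v hv
    rw [AddSubgroup.mem_comap, AddMonoidHom.mem_ker.1 hv]
    exact zero_mem _

lemma type_lat {p : ℕ} (hp : p.Prime) {r m : ℕ} {Λ' : Submodule ℤ (Fin m → ℤ)} {β : Fin m → ℕ}
    (e : ((Fin m → ℤ) ⧸ Λ') ≃+ ((i : Fin m) → ZMod (p ^ β i))) (hβ : Monotone β)
    {α : Fin (m + 1) → ℕ} (hα : Monotone α) (x : (Fin m → ℤ) ⧸ Λ') :
    Nonempty (((Fin (m + 1) → ℤ) ⧸ lat p r Λ' x) ≃+ ((i : Fin (m + 1)) → ZMod (p ^ α i))) ↔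
      isAdmissible r α β (dval p (e x)) := by
  rw [type_iff hp _ _ (lat_bound e x) hα,
    adm_iff_sums hα hβ (fun i => (dval_spec hp (e x) i).1)]
  apply forall_congr'
  intro t
  have h := NN_lat hp (r := r) e x t
  have hpos : 0 < p ^ EE r β (dval p (e x)) t := pow_pos hp.pos _
  constructor
  · intro h1
    rw [h1, ← pow_add] at h
    have := Nat.pow_right_injective hp.two_le h
    omega
  · intro h1
    rw [← h1, add_comm (∑ i, min (α i) t), pow_add] at h
    exact Nat.eq_of_mul_eq_mul_left hpos h

lemma card_gcd {p : ℕ} (hp : p.Prime) {b d : ℕ} (hd : d ≤ b) [NeZero (p ^ b)] :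
    (Finset.univ.filter fun a : ZMod (p ^ b) => Nat.gcd (p ^ b) a.val = p ^ d).card =
      if d < b then p ^ (b - d) - p ^ (b - d - 1) else 1 := by
  have h1 := Nat.totient_div_of_dvd (pow_dvd_pow p hd)
  have h2 : (Finset.univ.filter fun a : ZMod (p ^ b) => Nat.gcd (p ^ b) a.val = p ^ d).card =
      ((Finset.range (p ^ b)).filter fun k => (p ^ b).gcd k = p ^ d).card := by
    apply Finset.card_nbij' (fun a : ZMod (p ^ b) => a.val) (fun k : ℕ => (k : ZMod (p ^ b)))
    · intro a ha
      simp at ha ⊢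
      exact ⟨ZMod.val_lt a, ha⟩
    · intro k hk
      simp at hk ⊢
      rw [Nat.mod_eq_of_lt hk.1]
      exact hk.2
    · intro a _
      simp
    · intro k hk
      simp at hk ⊢
      exact Nat.mod_eq_of_lt hk.1
  rw [h2, ← h1, Nat.pow_div hd hp.pos]
  split_ifs with h
  · rw [Nat.totient_prime_pow hp (by omega), Nat.mul_sub, mul_one, ← pow_succ,
      Nat.sub_add_cancel (by omega)]
  · rw [show b - d = 0 by omega]
    simp

open scoped Classical in
lemma card_fiber {p : ℕ} (hp : p.Prime) {r m k : ℕ} {Λ' : Submodule ℤ (Fin m → ℤ)}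
    {β : Fin m → ℕ}
    (e : ((Fin m → ℤ) ⧸ Λ') ≃+ ((i : Fin m) → ZMod (p ^ β i))) (hβ : Monotone β)
    (hβk : ∀ i, β i ≤ k) {α : Fin (m + 1) → ℕ} (hα : Monotone α) :
    Nat.card {x : (Fin m → ℤ) ⧸ Λ' // Nonempty (((Fin (m + 1) → ℤ) ⧸ lat p r Λ' x) ≃+
      ((i : Fin (m + 1)) → ZMod (p ^ α i)))} =
    ∑ δ ∈ (Fintype.piFinset fun _ : Fin m => Finset.range (k + 1)).filter
                (fun δ => isAdmissible r α β δ), tau p β δ := by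
  have hne : ∀ i, NeZero (p ^ β i) := fun i => ⟨(pow_pos hp.pos _).ne'⟩
  rw [Nat.card_congr (e.toEquiv.subtypeEquiv (p := fun x => Nonempty (((Fin (m + 1) → ℤ) ⧸
    lat p r Λ' x) ≃+ ((i : Fin (m + 1)) → ZMod (p ^ α i))))
    (q := fun y => isAdmissible r α β (dval p y)) (fun x => type_lat hp e hβ hα x))]
  rw [Nat.card_eq_fintype_card, Fintype.card_subtype]
  rw [Finset.card_eq_sum_card_fiberwise (f := fun y => dval p y)
    (t := (Fintype.piFinset fun _ : Fin m => Finset.range (k + 1)).filter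
                (fun δ => isAdmissible r α β δ))]
  · apply Finset.sum_congr rfl
    intro δ hδ
    have hadm := (Finset.mem_filter.1 hδ).2
    have hle := hadm.1
    have : ((Finset.univ.filter fun y : (i : Fin m) → ZMod (p ^ β i) =>
        isAdmissible r α β (dval p y)).filter fun y => dval p y = δ) =
        Fintype.piFinset fun i =>
          Finset.univ.filter fun a : ZMod (p ^ β i) => Nat.gcd (p ^ β i) a.val = p ^ δ i := by
      ext y
      simp only [Finset.mem_filter, Finset.mem_univ, true_and, Fintype.mem_piFinset]
      constructor
      · rintro ⟨-, rfl⟩ i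
        exact (dval_spec hp y i).2
      · intro h
        have h1 : dval p y = δ := by
          ext i
          have := h i
          rw [(dval_spec hp y i).2] at this
          exact Nat.pow_right_injective hp.two_le this
        exact ⟨h1 ▸ hadm, h1⟩
    rw [this, Fintype.card_piFinset]
    unfold tau
    rw [Finset.prod_filter]
    exact Finset.prod_congr rfl fun i _ => card_gcd hp (hle i)
  · intro y hy
    simp only [Finset.coe_filter, Finset.mem_univ, true_and, Set.mem_ofPred_eq,
      Fintype.mem_piFinset, Finset.mem_range] at hy ⊢
    refine ⟨fun i => ?_, hy⟩
    have := (dval_spec hp y i).1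
    have := hβk i
    omega

lemma finite_types {p : ℕ} (hp : p.Prime) {n : ℕ} (β : Fin n → ℕ) :
    Finite {Λ : Submodule ℤ (Fin n → ℤ) //
      Nonempty (((Fin n → ℤ) ⧸ Λ) ≃+ ((i : Fin n) → ZMod (p ^ β i)))} := by
  have hne : ∀ i, NeZero (p ^ β i) := fun i => ⟨(pow_pos hp.pos _).ne'⟩
  let b := Pi.basisFun ℤ (Fin n)
  let F : (Fin n → ((i : Fin n) → ZMod (p ^ β i))) → Submodule ℤ (Fin n → ℤ) := fun g =>
    LinearMap.ker (b.constr ℤ g)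
  have : Set.Finite {Λ : Submodule ℤ (Fin n → ℤ) |
      Nonempty (((Fin n → ℤ) ⧸ Λ) ≃+ ((i : Fin n) → ZMod (p ^ β i)))} := by
    apply (Set.finite_range F).subset
    rintro Λ ⟨e⟩
    let f : (Fin n → ℤ) →ₗ[ℤ] ((i : Fin n) → ZMod (p ^ β i)) :=
      e.toAddMonoidHom.toIntLinearMap.comp Λ.mkQ
    refine ⟨fun i => f (b i), ?_⟩
    have h1 : b.constr ℤ (fun i => f (b i)) = f := b.ext fun i => by simp
    simp only [F]
    rw [h1]
    ext v
    rw [LinearMap.mem_ker]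
    have : f v = e (Submodule.Quotient.mk v) := rfl
    rw [this, EmbeddingLike.map_eq_zero_iff, Submodule.Quotient.mk_eq_zero]
  exact this

lemma lat_inj1 {p : ℕ} (hp : p.Prime) {m r : ℕ} {Λ' : Submodule ℤ (Fin m → ℤ)}
    {x : (Fin m → ℤ) ⧸ Λ'} (w : Fin m → ℤ) :
    (Fin.cons 0 w : Fin (m + 1) → ℤ) ∈ lat p r Λ' x ↔ w ∈ Λ' := by
  have hne : ((p ^ r : ℕ) : ℤ) ≠ 0 := by exact_mod_cast (pow_pos hp.pos r).ne'
  rw [mem_lat]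
  simp only [Fin.cons_zero, Fin.tail_cons]
  rw [← Submodule.Quotient.mk_eq_zero]
  constructor
  · rintro ⟨c, h1, h2⟩
    rcases mul_eq_zero.1 h1 with rfl | h
    · rw [← h2, zero_smul]
    · exact absurd h hne
  · intro h
    exact ⟨0, by simp, by rw [h, zero_smul]⟩

lemma lat_mem_gen {p : ℕ} {m r : ℕ} {Λ' : Submodule ℤ (Fin m → ℤ)}
    (w : Fin m → ℤ) :
    (Fin.cons ((p ^ r : ℕ) : ℤ) w : Fin (m + 1) → ℤ) ∈ lat p r Λ' (Submodule.Quotient.mk w) := by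
  rw [mem_lat]
  exact ⟨1, by simp, by simp⟩

lemma lat_inj2 {p : ℕ} (hp : p.Prime) {m r s : ℕ} {Λ' : Submodule ℤ (Fin m → ℤ)}
    {x y : (Fin m → ℤ) ⧸ Λ'} (h : lat p r Λ' x = lat p s Λ' y) : r = s ∧ x = y := by
  obtain ⟨w, rfl⟩ := Submodule.Quotient.mk_surjective Λ' x
  obtain ⟨w', rfl⟩ := Submodule.Quotient.mk_surjective Λ' y
  have h1 := lat_mem_gen (p := p) (r := r) (Λ' := Λ') w
  have h2 := lat_mem_gen (p := p) (r := s) (Λ' := Λ') w'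
  rw [h, mem_lat] at h1
  rw [← h, mem_lat] at h2
  obtain ⟨c, hc, hc'⟩ := h1
  obtain ⟨d, hd, -⟩ := h2
  simp only [Fin.cons_zero, Fin.tail_cons] at hc hd hc'
  have e1 : p ^ s ∣ p ^ r := Int.natCast_dvd_natCast.1 ⟨c, by rw [← hc]; ring⟩
  have e2 : p ^ r ∣ p ^ s := Int.natCast_dvd_natCast.1 ⟨d, by rw [← hd]; ring⟩
  have l1 := (Nat.pow_dvd_pow_iff_le_right hp.one_lt).1 e1
  have l2 := (Nat.pow_dvd_pow_iff_le_right hp.one_lt).1 e2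
  obtain rfl : r = s := by omega
  have hne : ((p ^ r : ℕ) : ℤ) ≠ 0 := by exact_mod_cast (pow_pos hp.pos r).ne'
  obtain rfl : c = 1 := by
    apply mul_right_cancel₀ hne
    rw [hc, one_mul]
  refine ⟨rfl, ?_⟩
  rw [← hc', one_smul]

lemma lat_surj {p : ℕ} (hp : p.Prime) {m K : ℕ} (Λ : Submodule ℤ (Fin (m + 1) → ℤ))
    (hK : ∀ v, ((p ^ K : ℕ) : ℤ) • v ∈ Λ) :
    ∃ (r : ℕ) (Λ' : Submodule ℤ (Fin m → ℤ)) (x : (Fin m → ℤ) ⧸ Λ'),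
      (∀ w, ((p ^ K : ℕ) : ℤ) • w ∈ Λ') ∧ lat p r Λ' x = Λ := by
  let I : AddSubgroup ℤ := Λ.toAddSubgroup.map (Pi.evalAddMonoidHom (fun _ : Fin (m + 1) => ℤ) 0)
  have hmemI : ∀ a, a ∈ I ↔ ∃ v ∈ Λ, v 0 = a := fun a => Iff.rfl
  obtain ⟨d, hd⟩ := Int.subgroup_cyclic I
  have hd' : ∀ a, a ∈ I ↔ d ∣ a := by
    intro a
    rw [hd, ← AddSubgroup.zmultiples_eq_closure, Int.mem_zmultiples_iff]
  have h1 : ((p ^ K : ℕ) : ℤ) ∈ I := by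
    rw [hmemI]
    exact ⟨_, hK (fun _ => 1), by simp⟩
  rw [hd', ← Int.natAbs_dvd, Int.natCast_dvd_natCast] at h1
  obtain ⟨r, -, hr⟩ := (Nat.dvd_prime_pow hp).1 h1
  have hI : ∀ a, a ∈ I ↔ ((p ^ r : ℕ) : ℤ) ∣ a := by
    intro a
    rw [hd', ← Int.natAbs_dvd, hr]
  obtain ⟨u, hu, hu0⟩ := (hmemI _).1 ((hI _).2 dvd_rfl)
  let Λ' : Submodule ℤ (Fin m → ℤ) :=
    { carrier := {w | (Fin.cons 0 w : Fin (m + 1) → ℤ) ∈ Λ}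
      zero_mem' := by
        have : (Fin.cons 0 0 : Fin (m + 1) → ℤ) = 0 := by
          ext i
          refine Fin.cases ?_ (fun j => ?_) i <;> simp
        simp only [Set.mem_ofPred_eq]
        rw [this]
        exact zero_mem _
      add_mem' := by
        intro a b ha hb
        have : (Fin.cons 0 (a + b) : Fin (m + 1) → ℤ) = Fin.cons 0 a + Fin.cons 0 b := by
          ext i
          refine Fin.cases ?_ (fun j => ?_) i <;> simp
        simp only [Set.mem_ofPred_eq] at ha hb ⊢
        rw [this]
        exact add_mem ha hb
      smul_mem' := by
        intro c a ha
        have : (Fin.cons 0 (c • a) : Fin (m + 1) → ℤ) = c • (Fin.cons 0 a : Fin (m + 1) → ℤ) := by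
          ext i
          refine Fin.cases ?_ (fun j => ?_) i <;> simp
        simp only [Set.mem_ofPred_eq] at ha ⊢
        rw [this]
        exact Λ.smul_mem c ha }
  have hΛ' : ∀ w, w ∈ Λ' ↔ (Fin.cons 0 w : Fin (m + 1) → ℤ) ∈ Λ := fun w => Iff.rfl
  refine ⟨r, Λ', Submodule.Quotient.mk (Fin.tail u), ?_, ?_⟩
  · intro w
    have : (Fin.cons 0 (((p ^ K : ℕ) : ℤ) • w) : Fin (m + 1) → ℤ) =
        ((p ^ K : ℕ) : ℤ) • (Fin.cons 0 w : Fin (m + 1) → ℤ) := by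
      ext i
      refine Fin.cases ?_ (fun j => ?_) i <;> simp
    rw [hΛ', this]
    exact hK _
  · ext v
    have key : ∀ c : ℤ, c * ((p ^ r : ℕ) : ℤ) = v 0 →
        (c • (Submodule.Quotient.mk (Fin.tail u) : (Fin m → ℤ) ⧸ Λ') =
          Submodule.Quotient.mk (Fin.tail v) ↔ v ∈ Λ) := by
      intro c hc
      rw [← Submodule.Quotient.mk_smul, eq_comm, Submodule.Quotient.eq, hΛ']
      have : (Fin.cons 0 (Fin.tail v - c • Fin.tail u) : Fin (m + 1) → ℤ) = v - c • u := by
        ext i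
        refine Fin.cases ?_ (fun j => ?_) i
        · simp [hu0, ← hc]
        · simp [Fin.tail]
      rw [this]
      exact Submodule.sub_mem_iff_left _ (Λ.smul_mem c hu)
    rw [mem_lat]
    constructor
    · rintro ⟨c, hc, h⟩
      exact (key c hc).1 h
    · intro hv
      obtain ⟨c, hc⟩ := (hI (v 0)).1 ((hmemI _).2 ⟨v, hv, rfl⟩)
      have hc' : c * ((p ^ r : ℕ) : ℤ) = v 0 := by rw [hc]; ring
      exact ⟨c, hc', (key c hc').2 hv⟩

end lattices

open scoped Classical in
/-- the recursive formula
f_α(p) = ∑_{r₁=0}^{k} ∑_{β ∈ P(n−1, k−r₁)} f_β(p) · ∑_{δ ∈ T(r₁,α,β)} τ(β, δ)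
for a partition α ∈ P(n, k), n = m + 1 ≥ 2.  (Every β ∈ P(n−1, k−r₁) and every admissible
δ has all entries ≤ k, so the sums over `Fintype.piFinset` below range over exactly
P(n−1, k−r₁) and T(r₁, α, β).) -/
theorem stmt12 (p : ℕ) (hp : p.Prime) (m k : ℕ) (hm : 1 ≤ m)
    (α : Fin (m + 1) → ℕ) (hmono : Monotone α) (hsum : ∑ i, α i = k) :
    latCount p α =
      ∑ r₁ ∈ Finset.range (k + 1),
        ∑ β ∈ (Fintype.piFinset fun _ : Fin m => Finset.range (k + 1)).filter
            (fun β => Monotone β ∧ ∑ i, β i = k - r₁),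
          latCount p β *
            ∑ δ ∈ (Fintype.piFinset fun _ : Fin m => Finset.range (k + 1)).filter
                (fun δ => isAdmissible r₁ α β δ),
              tau p β δ := by
  let B : ℕ → Finset (Fin m → ℕ) := fun r₁ =>
    (Fintype.piFinset fun _ : Fin m => Finset.range (k + 1)).filter
            (fun β => Monotone β ∧ ∑ i, β i = k - r₁)
  let X : (r : Finset.range (k + 1)) → (β : B r) → Type := fun r β =>
    Σ Λ' : {Λ : Submodule ℤ (Fin m → ℤ) //
        Nonempty (((Fin m → ℤ) ⧸ Λ) ≃+ ((i : Fin m) → ZMod (p ^ β.1 i)))},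
      {x : (Fin m → ℤ) ⧸ Λ'.1 // Nonempty (((Fin (m + 1) → ℤ) ⧸ lat p r Λ'.1 x) ≃+
        ((i : Fin (m + 1)) → ZMod (p ^ α i)))}
  have hB : ∀ r β, β ∈ B r ↔ (∀ i, β i ≤ k) ∧ Monotone β ∧ ∑ i, β i = k - r := by
    intro r β
    simp [B]
  have hfin : ∀ (β : Fin m → ℕ) (Λ' : {Λ : Submodule ℤ (Fin m → ℤ) //
        Nonempty (((Fin m → ℤ) ⧸ Λ) ≃+ ((i : Fin m) → ZMod (p ^ β i)))}),
      Finite ((Fin m → ℤ) ⧸ Λ'.1) := by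
    rintro β ⟨Λ', ⟨e⟩⟩
    have hne : ∀ i, NeZero (p ^ β i) := fun i => ⟨(pow_pos hp.pos _).ne'⟩
    exact Finite.of_equiv _ e.toEquiv.symm
  have hXfin : ∀ r β, Finite (X r β) := by
    intro r β
    have := finite_types hp β.1
    have := hfin β.1
    simp only [X]
    infer_instance
  have hXcard : ∀ r β, Nat.card (X r β) = latCount p β.1 *
      ∑ δ ∈ (Fintype.piFinset fun _ : Fin m => Finset.range (k + 1)).filter
                (fun δ => isAdmissible r.1 α β.1 δ), tau p β.1 δ := by
    intro r β
    have := finite_types hp β.1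
    have := hfin β.1
    have := Fintype.ofFinite {Λ : Submodule ℤ (Fin m → ℤ) //
        Nonempty (((Fin m → ℤ) ⧸ Λ) ≃+ ((i : Fin m) → ZMod (p ^ β.1 i)))}
    obtain ⟨b1, b2, b3⟩ := (hB _ _).1 β.2
    simp only [X]
    rw [Nat.card_sigma, Finset.sum_congr rfl (g := fun _ =>
      ∑ δ ∈ (Fintype.piFinset fun _ : Fin m => Finset.range (k + 1)).filter
                (fun δ => isAdmissible r.1 α β.1 δ), tau p β.1 δ)]
    · rw [Finset.sum_const, Finset.card_univ, smul_eq_mul, latCount, Nat.card_eq_fintype_card]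
    · rintro ⟨Λ', ⟨e⟩⟩ -
      exact card_fiber hp e b2 b1 hmono
  let F : (Σ r, Σ β, X r β) → {Λ : Submodule ℤ (Fin (m + 1) → ℤ) //
      Nonempty (((Fin (m + 1) → ℤ) ⧸ Λ) ≃+ ((i : Fin (m + 1)) → ZMod (p ^ α i)))} :=
    fun q => ⟨lat p q.1 q.2.2.1.1 q.2.2.2.1, q.2.2.2.2⟩
  have hF : Function.Bijective F := by
    constructor
    · rintro ⟨⟨r, hr⟩, ⟨β, hβ⟩, ⟨Λ', hΛ'⟩, ⟨x, hx⟩⟩ ⟨⟨s, hs⟩, ⟨γ, hγ⟩, ⟨Λ₂, hΛ₂⟩, ⟨y, hy⟩⟩ h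
      have h : lat p r Λ' x = lat p s Λ₂ y := congrArg Subtype.val h
      obtain rfl : Λ' = Λ₂ := by
        ext w
        rw [← lat_inj1 hp (r := r) (x := x) w, h, lat_inj1 hp]
      obtain ⟨rfl, rfl⟩ := lat_inj2 hp h
      obtain rfl : β = γ := by
        obtain ⟨e⟩ := hΛ'
        obtain ⟨e'⟩ := hΛ₂
        exact type_unique hp ((hB _ _).1 hβ).2.1 ((hB _ _).1 hγ).2.1 e e'
      rfl
    · rintro ⟨Λ, ⟨e⟩⟩
      obtain ⟨r, Λ', x, hK, rfl⟩ := lat_surj hp Λ (type_bound Λ e)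
      obtain ⟨β, hβ, ⟨e'⟩⟩ := exists_type hp Λ' _ hK
      have hadm := (type_lat hp e' hβ hmono x).1 ⟨e⟩
      have hs := (sum_eq_of_adm hmono hβ hadm.1 hadm).symm
      · have hr : r ∈ Finset.range (k + 1) := by
          rw [Finset.mem_range]
          omega
        have hb : β ∈ B r := by
          rw [hB]
          refine ⟨fun i => ?_, hβ, by omega⟩
          have := Finset.single_le_sum (f := β) (fun _ _ => Nat.zero_le _) (Finset.mem_univ i)
          omega
        exact ⟨⟨⟨r, hr⟩, ⟨β, hb⟩, ⟨Λ', ⟨e'⟩⟩, ⟨x, ⟨e⟩⟩⟩, rfl⟩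
  have hcard : latCount p α = Nat.card (Σ r, Σ β, X r β) :=
    (Nat.card_congr (Equiv.ofBijective F hF)).symm
  rw [hcard, Nat.card_sigma, ← Finset.sum_coe_sort (Finset.range (k + 1))]
  refine Finset.sum_congr rfl fun r _ => ?_
  rw [Nat.card_sigma]
  refine Eq.trans ?_ (Finset.sum_coe_sort (B r) (fun β => latCount p β *
      ∑ δ ∈ (Fintype.piFinset fun _ : Fin m => Finset.range (k + 1)).filter
                (fun δ => isAdmissible r.1 α β δ), tau p β δ))
  exact Finset.sum_congr rfl fun β _ => hXcard r β
end

section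
/- For every n ≥ 1, every k ≥ 0, and every partition α ∈ P(n,k), there exists a polynomial g_α with integer coefficients such that for every prime p, f_α(p) = g_α(p). -/
namespace LatC
open Function

/-- Subgroup-count times automorphisms equals surjections. -/
theorem card_mul_aut {M G : Type*} [AddCommGroup M] [AddCommGroup G] :
    Nat.card {L : Submodule ℤ M // Nonempty ((M ⧸ L) ≃+ G)} * Nat.card (G ≃+ G)
      = Nat.card {φ : M →+ G // Surjective φ} := by
  rw [← Nat.card_prod]
  let F : {L : Submodule ℤ M // Nonempty ((M ⧸ L) ≃+ G)} × (G ≃+ G) →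
      {φ : M →+ G // Surjective φ} := fun x =>
    ⟨((x.1.2.some.trans x.2 : (M ⧸ x.1.1) ≃+ G) : (M ⧸ x.1.1) →+ G).comp
      (x.1.1.mkQ.toAddMonoidHom),
      (x.1.2.some.trans x.2).surjective.comp (Submodule.mkQ_surjective _)⟩
  have hF : ∀ x m, (F x).1 m = x.2 (x.1.2.some (x.1.1.mkQ m)) := fun x m => rfl
  have hker : ∀ x m, (F x).1 m = 0 ↔ m ∈ x.1.1 := by
    intro x m
    rw [hF]
    simp
  apply Nat.card_congr
  refine Equiv.ofBijective F ⟨?_, ?_⟩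
  · rintro ⟨⟨L, hL⟩, e⟩ ⟨⟨L', hL'⟩, e'⟩ h
    have hLL : L = L' := by
      ext m
      rw [← hker ⟨⟨L, hL⟩, e⟩ m, h, hker]
    subst hLL
    congr 1
    ext g
    obtain ⟨q, hq⟩ := hL.some.surjective g
    obtain ⟨m, hm⟩ := L.mkQ_surjective q
    have h1 := hF ⟨⟨L, hL⟩, e⟩ m
    rw [h, hF] at h1
    simp only at h1
    rw [hm, hq] at h1
    exact h1.symm
  · rintro ⟨φ, hφ⟩
    let e0 : (M ⧸ LinearMap.ker φ.toIntLinearMap) ≃+ G :=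
      (φ.toIntLinearMap.quotKerEquivOfSurjective hφ).toAddEquiv
    refine ⟨⟨⟨LinearMap.ker φ.toIntLinearMap, ⟨e0⟩⟩,
      (Nonempty.some ⟨e0⟩ : _ ≃+ G).symm.trans e0⟩, ?_⟩
    ext m
    rw [hF]
    show e0 ((Nonempty.some ⟨e0⟩ : _ ≃+ G).symm ((Nonempty.some ⟨e0⟩ : _ ≃+ G) _)) = _
    rw [AddEquiv.symm_apply_apply]
    rfl

theorem card_fiber {X Y : Type*} [AddCommGroup X] [AddCommGroup Y] [Finite X] [Finite Y]
    (f : X →+ Y) (P : Y → Prop) (hP : ∀ y, P y → ∃ x, f x = y) :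
    Nat.card {x // P (f x)} = Nat.card {x // f x = 0} * Nat.card {y // P y} := by
  rw [mul_comm, ← Nat.card_prod]
  choose s hs using fun y : {y // P y} => hP y.1 y.2
  refine Nat.card_congr ⟨fun x => (⟨f x.1, x.2⟩, ⟨x.1 - s ⟨f x.1, x.2⟩, ?_⟩),
    fun z => ⟨z.2.1 + s z.1, ?_⟩, ?_, ?_⟩
  · rw [map_sub, hs, sub_self]
  · rw [map_add, hs, z.2.2, zero_add]; exact z.1.2
  · intro x; simp
  · rintro ⟨⟨y, hy⟩, ⟨x, hx⟩⟩
    have : f (x + s ⟨y, hy⟩) = y := by rw [map_add, hs, hx, zero_add]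
    simp [this]

section vec
variable {p : ℕ} [Fact p.Prime]

theorem surj_iff_span {A V ι : Type*} [AddCommGroup A] [AddCommGroup V] [Module (ZMod p) V]
    (ψ : A →+ V) (e : ι → A) (he : AddSubgroup.closure (Set.range e) = ⊤) :
    Surjective ψ ↔ Submodule.span (ZMod p) (Set.range fun i => ψ (e i)) = ⊤ := by
  constructor
  · intro h
    rw [eq_top_iff]
    intro v _
    obtain ⟨a, rfl⟩ := h v
    have h1 : AddSubgroup.closure (Set.range e) ≤
      ((Submodule.span (ZMod p) (Set.range fun i => ψ (e i))).toAddSubgroup).comap ψ := by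
      rw [AddSubgroup.closure_le]
      rintro _ ⟨i, rfl⟩
      exact Submodule.subset_span ⟨i, rfl⟩
    exact h1 (he ▸ AddSubgroup.mem_top a)
  · intro h v
    have h1 : Submodule.span (ZMod p) (Set.range fun i => ψ (e i)) ≤
        AddSubgroup.toZModSubmodule p ψ.range := by
      rw [Submodule.span_le]
      rintro _ ⟨i, rfl⟩
      exact ⟨e i, rfl⟩
    have := h1 (h ▸ Submodule.mem_top : v ∈ _)
    exact this

theorem card_span_top (n r : ℕ) (h : r ≤ n) :
    (Nat.card {t : Fin n → (Fin r → ZMod p) // Submodule.span (ZMod p) (Set.range t) = ⊤} : ℤ)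
      = ∏ i : Fin r, ((p : ℤ) ^ n - (p : ℤ) ^ (i : ℕ)) := by
  have hc := card_linearIndependent (K := ZMod p) (V := Fin n → ZMod p) (k := r) (by simpa using h)
  rw [Module.finrank_fin_fun, ZMod.card] at hc
  have : Nat.card {t : Fin n → (Fin r → ZMod p) // Submodule.span (ZMod p) (Set.range t) = ⊤}
      = Nat.card {s : Fin r → (Fin n → ZMod p) // LinearIndependent (ZMod p) s} := by
    refine Nat.card_congr (Equiv.subtypeEquiv (Equiv.piComm _) ?_)
    intro t
    rw [linearIndependent_iff_card_eq_finrank_span, Set.finrank]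
    change _ ↔ _ = Module.finrank (ZMod p) (Submodule.span (ZMod p) (Set.range (Matrix.of
      ((Equiv.piComm fun (_ : Fin n) (_ : Fin r) => ZMod p) t)).row))
    rw [← Matrix.rank_eq_finrank_span_row]
    rw [show (Matrix.of ((Equiv.piComm fun (_ : Fin n) (_ : Fin r) => ZMod p) t))
      = (Matrix.of t).transpose from rfl, Matrix.rank_transpose, Matrix.rank_eq_finrank_span_row]
    rw [Fintype.card_fin]
    constructor
    · intro h
      rw [show Set.range (Matrix.of t).row = Set.range t from rfl, h]
      simp
    · intro h
      apply Submodule.eq_top_of_finrank_eq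
      rw [Module.finrank_fin_fun]
      exact h.symm
  rw [this, hc, Nat.cast_prod]
  refine Finset.prod_congr rfl fun i _ => ?_
  rw [Nat.cast_sub]
  · push_cast; rfl
  · exact Nat.pow_le_pow_right (Fact.out : p.Prime).pos (i.2.le.trans h)

theorem card_li {G V : Type*} [AddCommGroup G] [AddCommGroup V] [Module (ZMod p) V]
    [Finite G] [Finite V] (π : G →+ V) (m : ℕ) (b : Fin m → ℕ) (hb : Monotone b) :
    (Nat.card {g : Fin m → G // (∀ i, p ^ (b i) • g i = 0) ∧
      LinearIndependent (ZMod p) (fun i => π (g i))} : ℤ)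
    = ∏ i : Fin m, ((Nat.card {x : G // p ^ (b i) • x = 0} : ℤ) -
        (p : ℤ) ^ (i : ℕ) * Nat.card {x : G // p ^ (b i) • x = 0 ∧ π x = 0}) := by
  induction m with
  | zero =>
    have : Unique {g : Fin 0 → G // (∀ i, p ^ (b i) • g i = 0) ∧
      LinearIndependent (ZMod p) (fun i => π (g i))} :=
      { default := ⟨Fin.elim0, fun i => i.elim0, linearIndependent_empty_type⟩
        uniq := fun x => Subtype.ext (Subsingleton.elim _ _) }
    simp
  | succ m ih =>
    let b' : Fin m → ℕ := fun i => b i.castSucc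
    have hb' : Monotone b' := fun i j h => hb (Fin.castSucc_le_castSucc_iff.2 h)
    rw [Fin.prod_univ_castSucc]
    have ih' := ih b' hb'
    simp only [Fin.val_castSucc, Fin.val_last]
    rw [← ih']
    let S := {g : Fin m → G // (∀ i, p ^ (b' i) • g i = 0) ∧
      LinearIndependent (ZMod p) (fun i => π (g i))}
    let N := b (Fin.last m)
    let W : S → Submodule (ZMod p) V := fun h => Submodule.span (ZMod p) (Set.range fun i => π (h.1 i))
    have hext : ∀ a b : (Σ h : S, {x : G // p ^ N • x = 0 ∧ π x ∉ W h}),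
        a.1 = b.1 → a.2.1 = b.2.1 → a = b := by
      rintro ⟨h, x, hx⟩ ⟨h', x', hx'⟩ h1 h2
      simp only at h1 h2
      subst h1
      subst h2
      rfl
    let E : {g : Fin (m+1) → G // (∀ i, p ^ (b i) • g i = 0) ∧
      LinearIndependent (ZMod p) (fun i => π (g i))} ≃
        Σ h : S, {x : G // p ^ N • x = 0 ∧ π x ∉ W h} :=
      { toFun := fun g => ⟨⟨fun i => g.1 i.castSucc, fun i => g.2.1 _,
            (linearIndependent_finSucc'.1 g.2.2).1⟩,
            ⟨g.1 (Fin.last m), g.2.1 _, (linearIndependent_finSucc'.1 g.2.2).2⟩⟩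
        invFun := fun h => ⟨Fin.snoc (α := fun _ => G) h.1.1 h.2.1, by
            intro i
            refine Fin.lastCases ?_ (fun i => ?_) i
            · simpa using h.2.2.1
            · simpa using h.1.2.1 i, by
            rw [linearIndependent_finSucc']
            refine ⟨?_, ?_⟩
            · simpa [Fin.init_def] using h.1.2.2
            · simpa [Fin.init_def] using h.2.2.2⟩
        left_inv := by
          intro g
          apply Subtype.ext
          exact Fin.snoc_init_self (α := fun _ => G) g.1
        right_inv := by
          rintro ⟨⟨h, h1⟩, ⟨x, h2⟩⟩
          apply hext
          · simp
          · simp }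
    have : Fintype S := Fintype.ofFinite _
    rw [Nat.card_congr E, Nat.card_sigma]
    push_cast
    have key : ∀ h : S, (Nat.card {x : G // p ^ N • x = 0 ∧ π x ∉ W h} : ℤ) =
      ((Nat.card {x : G // p ^ N • x = 0} : ℤ) -
        (p : ℤ) ^ m * Nat.card {x : G // p ^ N • x = 0 ∧ π x = 0}) := by
      intro h
      let T : AddSubgroup G := (nsmulAddMonoidHom (α := G) (p ^ N)).ker
      have hT : ∀ x, x ∈ T ↔ p ^ N • x = 0 := fun x => Iff.rfl
      have hWr : W h ≤ AddSubgroup.toZModSubmodule p (T.map π) := by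
        rw [Submodule.span_le]
        rintro _ ⟨i, rfl⟩
        refine ⟨h.1 i, ?_, rfl⟩
        obtain ⟨c, hc⟩ := pow_dvd_pow p (hb (Fin.le_last i.castSucc))
        show p ^ N • h.1 i = 0
        rw [show p ^ N = c * p ^ (b' i) from by rw [mul_comm]; exact hc, mul_nsmul', h.2.1 i,
          nsmul_zero]
      have h1 := card_fiber (π.comp T.subtype) (fun y => y ∈ W h) (by
        intro y hy
        obtain ⟨x, hx, rfl⟩ := hWr hy
        exact ⟨⟨x, hx⟩, rfl⟩)
      have h2 : Nat.card {y // y ∈ W h} = p ^ m := by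
        have := Module.natCard_eq_pow_finrank (K := ZMod p) (V := W h)
        rw [finrank_span_eq_card h.2.2, Nat.card_zmod, Fintype.card_fin] at this
        exact this
      have h3 : Nat.card {x : T // (π.comp T.subtype) x ∈ W h} =
          Nat.card {x : G // p ^ N • x = 0 ∧ π x ∈ W h} :=
        Nat.card_congr (Equiv.subtypeSubtypeEquivSubtypeInter (fun x => x ∈ T) (fun x => π x ∈ W h))
      have h4 : Nat.card {x : T // (π.comp T.subtype) x = 0} =
          Nat.card {x : G // p ^ N • x = 0 ∧ π x = 0} :=
        Nat.card_congr (Equiv.subtypeSubtypeEquivSubtypeInter (fun x => x ∈ T) (fun x => π x = 0))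
      have h5 : Nat.card {x : G // p ^ N • x = 0} =
          Nat.card {x : G // p ^ N • x = 0 ∧ π x ∈ W h} +
          Nat.card {x : G // p ^ N • x = 0 ∧ π x ∉ W h} := by
        classical
        rw [← Nat.card_sum]
        refine Nat.card_congr ((Equiv.sumCompl (fun x : {x : G // p ^ N • x = 0} => π x.1 ∈ W h)).symm.trans
          (Equiv.sumCongr (Equiv.subtypeSubtypeEquivSubtypeInter (fun x => p ^ N • x = 0) (fun x => π x ∈ W h))
            (Equiv.subtypeSubtypeEquivSubtypeInter (fun x => p ^ N • x = 0) (fun x => π x ∉ W h))))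
      rw [h3, h4, h2] at h1
      rw [h5, h1]
      push_cast
      ring
    rw [Finset.sum_congr rfl (fun h _ => key h), Finset.sum_const, nsmul_eq_mul,
      Finset.card_univ, ← Nat.card_eq_fintype_card]
end vec
end LatC

namespace LatC
open Function

section concrete
variable {p : ℕ} [Fact p.Prime]

theorem cast_zero_iff {c : ℕ} (hc : 0 < c) (z : ZMod (p ^ c)) :
    ZMod.castHom (dvd_pow_self p hc.ne') (ZMod p) z = 0 ↔ ∃ a : ℕ, z = ((p * a : ℕ) : ZMod (p ^ c)) := by
  obtain ⟨a, rfl⟩ := ZMod.natCast_zmod_surjective z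
  rw [map_natCast]
  constructor
  · intro h
    rw [ZMod.natCast_eq_zero_iff] at h
    obtain ⟨b, rfl⟩ := h
    exact ⟨b, rfl⟩
  · rintro ⟨b, hb⟩
    rw [ZMod.natCast_eq_natCast_iff] at hb
    have := Nat.ModEq.of_dvd (dvd_pow_self p hc.ne') hb
    rw [← ZMod.natCast_eq_natCast_iff] at this
    rw [this]; simp

theorem cast_zero_iff' {c : ℕ} (hc : 0 < c) (z : ZMod (p ^ c)) :
    ZMod.castHom (dvd_pow_self p hc.ne') (ZMod p) z = 0 ↔ p ^ (c - 1) • z = 0 := by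
  obtain ⟨a, rfl⟩ := ZMod.natCast_zmod_surjective z
  rw [map_natCast, nsmul_eq_mul, ← Nat.cast_mul, ZMod.natCast_eq_zero_iff, ZMod.natCast_eq_zero_iff]
  obtain ⟨d, rfl⟩ : ∃ d, c = d + 1 := ⟨c - 1, by omega⟩
  rw [Nat.add_sub_cancel, pow_succ]
  exact (Nat.mul_dvd_mul_iff_left (pow_pos (Fact.out : p.Prime).pos _)).symm

theorem card_tor (c b : ℕ) :
    Nat.card {x : ZMod (p ^ c) // p ^ b • x = 0} = p ^ (min b c) := by
  have h := IsAddCyclic.card_nsmulAddMonoidHom_ker (ZMod (p ^ c)) (p ^ b)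
  rw [Nat.card_zmod] at h
  have h2 : (p ^ c).gcd (p ^ b) = p ^ min b c := by
    rcases le_total b c with hbc | hbc
    · rw [min_eq_left hbc, Nat.gcd_eq_right (pow_dvd_pow p hbc)]
    · rw [min_eq_right hbc, Nat.gcd_eq_left (pow_dvd_pow p hbc)]
  rw [← h2, ← h]
  rfl

theorem smul_min {G : Type*} [AddCommGroup G] (a b : ℕ) (x : G) :
    (p ^ a • x = 0 ∧ p ^ b • x = 0) ↔ p ^ (min a b) • x = 0 := by
  have aux : ∀ {a b : ℕ}, a ≤ b → p ^ a • x = 0 → p ^ b • x = 0 := by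
    intro a b h h0
    rw [← Nat.sub_add_cancel h, pow_add, mul_nsmul', h0, nsmul_zero]
  rcases le_total a b with h | h
  · rw [min_eq_left h]; exact ⟨fun h => h.1, fun h0 => ⟨h0, aux h h0⟩⟩
  · rw [min_eq_right h]; exact ⟨fun h => h.2, fun h0 => ⟨aux h h0, h0⟩⟩

variable {r : ℕ} (β : Fin r → ℕ) (hβ : ∀ i, 0 < β i)

/-- reduction mod p -/
def red : ((i : Fin r) → ZMod (p ^ β i)) →+ (Fin r → ZMod p) where
  toFun x i := ZMod.castHom (dvd_pow_self p (hβ i).ne') (ZMod p) (x i)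
  map_zero' := by ext i; simp
  map_add' x y := by ext i; exact map_add _ _ _

theorem red_surj : Surjective (red (p := p) β hβ) := by
  intro v
  choose a ha using fun i => ZMod.natCast_zmod_surjective (v i)
  refine ⟨fun i => (a i : ZMod (p ^ β i)), ?_⟩
  ext i
  show ZMod.castHom (dvd_pow_self p (hβ i).ne') (ZMod p) _ = _
  rw [map_natCast, ha]

theorem red_zero (x) (hx : red (p := p) β hβ x = 0) : ∃ w, x = p • w := by
  choose a ha using fun i => (cast_zero_iff (hβ i) (x i)).1 (congrFun hx i)
  refine ⟨fun i => (a i : ZMod (p ^ β i)), ?_⟩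
  ext i
  rw [ha]; simp

theorem surj_iff_red {A : Type*} [AddCommGroup A] (φ : A →+ ((i : Fin r) → ZMod (p ^ β i))) :
    Surjective φ ↔ Surjective ((red β hβ).comp φ) := by
  constructor
  · intro h
    exact (red_surj β hβ).comp h
  · intro h x
    have key : ∀ k : ℕ, ∃ a y, x = φ a + p ^ k • y := by
      intro k
      induction k with
      | zero => exact ⟨0, x, by simp⟩
      | succ k ih =>
        obtain ⟨a, y, hx⟩ := ih
        obtain ⟨b, hb⟩ := h (red β hβ y)
        obtain ⟨w, hw⟩ := red_zero β hβ (y - φ b) (by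
          rw [map_sub, ← hb]; simp)
        refine ⟨a + p ^ k • b, w, ?_⟩
        rw [hx, map_add, map_nsmul, pow_succ, mul_nsmul', ← hw, smul_sub]
        abel
    obtain ⟨a, y, hx⟩ := key (∑ i, β i)
    refine ⟨a, ?_⟩
    rw [hx]
    have : p ^ (∑ i, β i) • y = 0 := by
      ext i
      rw [Pi.smul_apply, nsmul_eq_mul]
      have : ((p ^ (∑ i, β i) : ℕ) : ZMod (p ^ β i)) = 0 := by
        rw [ZMod.natCast_eq_zero_iff]
        exact pow_dvd_pow p (Finset.single_le_sum (f := β) (fun _ _ => Nat.zero_le _) (Finset.mem_univ i))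
      rw [this, zero_mul]; rfl
    rw [this, add_zero]

theorem card_T (b : ℕ) : Nat.card {x : (i : Fin r) → ZMod (p ^ β i) // p ^ b • x = 0}
    = p ^ (∑ i, min b (β i)) := by
  have : Nat.card {x : (i : Fin r) → ZMod (p ^ β i) // p ^ b • x = 0} =
      Nat.card ((i : Fin r) → {x : ZMod (p ^ β i) // p ^ b • x = 0}) :=
    Nat.card_congr ((Equiv.subtypeEquivRight (fun x => by rw [funext_iff]; rfl)).trans
      Equiv.subtypePiEquivPi)
  rw [this, Nat.card_pi, ← Finset.prod_pow_eq_pow_sum]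
  exact Finset.prod_congr rfl fun i _ => card_tor _ _

theorem card_K (b : ℕ) : Nat.card {x : (i : Fin r) → ZMod (p ^ β i) //
    p ^ b • x = 0 ∧ red β hβ x = 0} = p ^ (∑ i, min b (β i - 1)) := by
  have : Nat.card {x : (i : Fin r) → ZMod (p ^ β i) // p ^ b • x = 0 ∧ red β hβ x = 0} =
      Nat.card ((i : Fin r) → {x : ZMod (p ^ β i) // p ^ (min b (β i - 1)) • x = 0}) := by
    refine Nat.card_congr ((Equiv.subtypeEquivRight (fun x => ?_)).trans
      Equiv.subtypePiEquivPi)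
    rw [funext_iff, funext_iff, ← forall_and]
    refine forall_congr' fun i => ?_
    rw [← smul_min]
    exact and_congr Iff.rfl (cast_zero_iff' (hβ i) (x i))
  rw [this, Nat.card_pi, ← Finset.prod_pow_eq_pow_sum]
  refine Finset.prod_congr rfl fun i _ => ?_
  rw [card_tor]
  congr 1
  omega

theorem card_ker : Nat.card {x : (i : Fin r) → ZMod (p ^ β i) // red β hβ x = 0} =
    p ^ (∑ i, (β i - 1)) := by
  have : Nat.card {x : (i : Fin r) → ZMod (p ^ β i) // red β hβ x = 0} =
      Nat.card ((i : Fin r) → {x : ZMod (p ^ β i) // p ^ (β i - 1) • x = 0}) := by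
    refine Nat.card_congr ((Equiv.subtypeEquivRight (fun x => ?_)).trans
      Equiv.subtypePiEquivPi)
    rw [funext_iff]
    exact forall_congr' fun i => cast_zero_iff' (hβ i) (x i)
  rw [this, Nat.card_pi, ← Finset.prod_pow_eq_pow_sum]
  refine Finset.prod_congr rfl fun i _ => ?_
  rw [card_tor]
  congr 1
  omega

theorem closure_single {ι : Type*} [Fintype ι] [DecidableEq ι] (N : ι → ℕ) :
    AddSubgroup.closure (Set.range fun i => (Pi.single i 1 : (i : ι) → ZMod (N i))) = ⊤ := by
  rw [eq_top_iff]
  intro x _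
  rw [← Finset.univ_sum_single x]
  refine AddSubgroup.sum_mem _ fun i _ => ?_
  obtain ⟨a, ha⟩ := ZMod.intCast_surjective (x i)
  have : (Pi.single i (x i) : (i : ι) → ZMod (N i)) = a • Pi.single i 1 := by
    rw [← Pi.single_smul, ← ha]; simp
  rw [this]
  exact AddSubgroup.zsmul_mem _ (AddSubgroup.subset_closure (Set.mem_range_self i)) _

/-- Homs out of a product of cyclic groups. -/
theorem card_hom {ι : Type*} [Fintype ι] [DecidableEq ι] (N : ι → ℕ) {G : Type*} [AddCommGroup G]
    (P : (ι → G) → Prop) :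
    Nat.card {φ : ((i : ι) → ZMod (N i)) →+ G // P (fun i => φ (Pi.single i 1))}
      = Nat.card {g : ι → G // (∀ i, N i • g i = 0) ∧ P g} := by
  have h0 : ∀ (φ : ((i : ι) → ZMod (N i)) →+ G) (i : ι), N i • φ (Pi.single i 1) = 0 := by
    intro φ i
    rw [← map_nsmul, ← Pi.single_smul]
    simp
  refine Nat.card_congr (Equiv.ofBijective (β := {g : ι → G // (∀ i, N i • g i = 0) ∧ P g})
    (fun φ => ⟨fun i => φ.1 (Pi.single i 1), h0 φ.1, φ.2⟩) ⟨?_, ?_⟩)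
  · intro φ ψ h
    apply Subtype.ext
    have h' := congrArg Subtype.val h
    refine AddMonoidHom.eq_of_eqOn_dense (closure_single N) ?_
    rintro _ ⟨i, rfl⟩
    exact congrFun h' i
  · rintro ⟨g, hg, hP⟩
    let f : (i : ι) → ZMod (N i) →+ G := fun i => ZMod.lift (N i) ⟨zmultiplesHom G (g i), by
      simpa using hg i⟩
    let φ : ((i : ι) → ZMod (N i)) →+ G := ∑ i, (f i).comp (Pi.evalAddMonoidHom _ i)
    have hφ : (fun i => φ (Pi.single i 1)) = g := by
      funext i
      simp only [φ, AddMonoidHom.finsetSum_apply, AddMonoidHom.comp_apply, Pi.evalAddMonoidHom_apply]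
      rw [Finset.sum_eq_single i]
      · have : (1 : ZMod (N i)) = ((1 : ℤ) : ZMod (N i)) := by simp
        rw [Pi.single_eq_same, this]
        simp only [f]
        rw [ZMod.lift_coe]
        simp
      · intro j _ hj
        rw [Pi.single_eq_of_ne hj, map_zero]
      · simp
    exact ⟨⟨φ, by rw [hφ]; exact hP⟩, Subtype.ext hφ⟩

theorem card_aut (hβ : ∀ i, 0 < β i) (hm : Monotone β) :
    (Nat.card (((i : Fin r) → ZMod (p ^ β i)) ≃+ ((i : Fin r) → ZMod (p ^ β i))) : ℤ) =
    ∏ j : Fin r, ((p : ℤ) ^ (∑ i, min (β j) (β i)) -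
      (p : ℤ) ^ ((j : ℕ) + ∑ i, min (β j) (β i - 1))) := by
  have h1 : Nat.card (((i : Fin r) → ZMod (p ^ β i)) ≃+ ((i : Fin r) → ZMod (p ^ β i))) =
      Nat.card {φ : ((i : Fin r) → ZMod (p ^ β i)) →+ ((i : Fin r) → ZMod (p ^ β i)) //
        Surjective φ} := by
    refine Nat.card_congr (Equiv.ofBijective (fun e => ⟨e.toAddMonoidHom, e.surjective⟩) ⟨?_, ?_⟩)
    · intro e e' h
      ext1 x
      exact DFunLike.congr_fun (congrArg Subtype.val h) x
    · rintro ⟨φ, h⟩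
      refine ⟨AddEquiv.ofBijective φ ⟨Finite.injective_iff_surjective.2 h, h⟩, ?_⟩
      apply Subtype.ext
      ext1 x
      rfl
  have h2 : ∀ φ : ((i : Fin r) → ZMod (p ^ β i)) →+ ((i : Fin r) → ZMod (p ^ β i)),
      Surjective φ ↔ LinearIndependent (ZMod p) (fun j => red β hβ (φ (Pi.single j 1))) := by
    intro φ
    rw [surj_iff_red β hβ, surj_iff_span (p := p) _ _ (closure_single fun i => p ^ β i)]
    rw [linearIndependent_iff_card_eq_finrank_span, Set.finrank, Fintype.card_fin]
    constructor
    · intro h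
      have h' : Submodule.span (ZMod p) (Set.range fun j => red β hβ (φ (Pi.single j 1))) = ⊤ := h
      rw [h']
      simp
    · intro h
      apply Submodule.eq_top_of_finrank_eq
      rw [Module.finrank_fin_fun]
      exact h.symm
  rw [h1, Nat.card_congr (Equiv.subtypeEquivRight h2),
    card_hom (fun i => p ^ β i) (fun g => LinearIndependent (ZMod p) (fun j => red β hβ (g j)))]
  refine (card_li (p := p) (G := (i : Fin r) → ZMod (p ^ β i)) (V := Fin r → ZMod p)
    (red β hβ) r β hm).trans ?_
  refine Finset.prod_congr rfl fun j _ => ?_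
  rw [card_T, card_K, pow_add]
  push_cast
  rfl

theorem card_surj (hβ : ∀ i, 0 < β i) (n : ℕ) (h : r ≤ n) :
    (Nat.card {φ : (Fin n → ℤ) →+ ((i : Fin r) → ZMod (p ^ β i)) // Surjective φ} : ℤ) =
    (p : ℤ) ^ ((∑ i, (β i - 1)) * n) * ∏ i : Fin r, ((p : ℤ) ^ n - (p : ℤ) ^ (i : ℕ)) := by
  have h2 : ∀ φ : (Fin n → ℤ) →+ ((i : Fin r) → ZMod (p ^ β i)),
      Surjective φ ↔ Submodule.span (ZMod p)
        (Set.range (fun j => red β hβ (φ (Pi.single j 1)))) = ⊤ := by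
    intro φ
    rw [surj_iff_red β hβ]
    exact surj_iff_span (p := p) (A := Fin n → ℤ) ((red β hβ).comp φ)
      (fun i : Fin n => Pi.single i 1) (closure_single (ι := Fin n) fun i => 0)
  have h3 := card_hom (ι := Fin n) (fun i => 0) (G := (i : Fin r) → ZMod (p ^ β i))
    (fun g => Submodule.span (ZMod p) (Set.range (fun j => red β hβ (g j))) = ⊤)
  have h4 := card_fiber ((red (p := p) β hβ).compLeft (Fin n))
    (fun t => Submodule.span (ZMod p) (Set.range t) = ⊤) (by
      intro y _
      choose x hx using fun i => red_surj β hβ (y i)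
      exact ⟨x, funext hx⟩)
  have h5 : Nat.card {x // (red (p := p) β hβ).compLeft (Fin n) x = 0} =
      p ^ ((∑ i, (β i - 1)) * n) := by
    rw [pow_mul, ← card_ker β hβ]
    rw [Nat.card_congr ((Equiv.subtypeEquivRight (fun x => by rw [funext_iff]; rfl)).trans
      (Equiv.subtypePiEquivPi (p := fun (_ : Fin n) x => red (p := p) β hβ x = 0))), Nat.card_pi]
    simp
  rw [Nat.card_congr (Equiv.subtypeEquivRight h2)]
  have h6 : Nat.card {φ : (Fin n → ℤ) →+ ((i : Fin r) → ZMod (p ^ β i)) //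
      Submodule.span (ZMod p) (Set.range (fun j => red β hβ (φ (Pi.single j 1)))) = ⊤} =
      Nat.card {g : Fin n → (i : Fin r) → ZMod (p ^ β i) //
        Submodule.span (ZMod p) (Set.range ((red (p := p) β hβ).compLeft (Fin n) g)) = ⊤} := by
    refine Eq.trans h3 (Nat.card_congr (Equiv.subtypeEquivRight fun g => ?_))
    simp only [zero_smul, implies_true, true_and]
    rfl
  rw [h6, h4, h5, Nat.cast_mul, card_span_top n r h]
  push_cast
  rfl

end concrete

open Polynomial in
theorem poly_quot (A B : ℤ[X]) (hB : B.Monic) (f : ℕ → ℕ)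
    (h : ∀ p : ℕ, p.Prime → (f p : ℤ) * B.eval (p : ℤ) = A.eval (p : ℤ))
    (h0 : ∀ p : ℕ, p.Prime → B.eval (p : ℤ) ≠ 0) :
    ∃ g : ℤ[X], ∀ p : ℕ, p.Prime → (f p : ℤ) = g.eval (p : ℤ) := by
  have hR : A %ₘ B = 0 := by
    set R := A %ₘ B with hRdef
    have hd : R.degree < B.degree := degree_modByMonic_lt A hB
    have hlim := Polynomial.div_tendsto_atTop_zero_of_degree_lt (R.map (Int.castRingHom ℝ))
      (B.map (Int.castRingHom ℝ)) (by
        rw [degree_map_eq_of_injective (RingHom.injective_int _),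
          degree_map_eq_of_injective (RingHom.injective_int _)]; exact hd)
    have hlim' := hlim.comp (tendsto_natCast_atTop_atTop (R := ℝ))
    have hev := hlim'.eventually (Metric.ball_mem_nhds (0 : ℝ) one_pos)
    obtain ⟨N, hN⟩ := Filter.eventually_atTop.1 hev
    by_contra hne
    have hroot : ∀ p : ℕ, N ≤ p → p.Prime → R.eval (p : ℤ) = 0 := by
      intro p hp hpp
      have h1 := hN p hp
      have e : ∀ Q : ℤ[X], (Q.map (Int.castRingHom ℝ)).eval ((p : ℕ) : ℝ) = ((Q.eval (p : ℤ) : ℤ) : ℝ) := by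
        intro Q
        have := Polynomial.eval_intCast_map (Int.castRingHom ℝ) Q (p : ℤ)
        simpa using this
      simp only [Function.comp_apply, e, Metric.mem_ball, dist_zero_right, norm_div] at h1
      have hBne : ((B.eval (p : ℤ) : ℤ) : ℝ) ≠ 0 := by exact_mod_cast h0 p hpp
      rw [div_lt_one (norm_pos_iff.2 hBne)] at h1
      have h2 : |R.eval (p : ℤ)| < |B.eval (p : ℤ)| := by
        rw [Real.norm_eq_abs, Real.norm_eq_abs] at h1
        exact_mod_cast h1
      have h3 : A.eval (p : ℤ) = R.eval (p : ℤ) + B.eval (p : ℤ) * (A /ₘ B).eval (p : ℤ) := by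
        rw [← eval_mul, ← eval_add, hRdef, modByMonic_add_div]
      have h4 : B.eval (p : ℤ) ∣ R.eval (p : ℤ) := by
        refine ⟨f p - (A /ₘ B).eval (p : ℤ), ?_⟩
        have := h p hpp
        linarith [mul_sub (B.eval (p : ℤ)) (f p) ((A /ₘ B).eval (p : ℤ)), mul_comm (B.eval (p : ℤ)) (f p)]
      exact Int.eq_zero_of_abs_lt_dvd ((abs_dvd _ _).2 h4) h2
    apply hne
    apply Polynomial.eq_zero_of_infinite_isRoot
    have hinf : Set.Infinite {p : ℕ | N ≤ p ∧ p.Prime} := by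
      rw [Set.infinite_iff_exists_gt]
      intro a
      obtain ⟨q, hq, hqp⟩ := Nat.exists_infinite_primes (N + a + 1)
      exact ⟨q, ⟨by omega, hqp⟩, by omega⟩
    refine (hinf.image (f := fun p : ℕ => (p : ℤ)) (Nat.cast_injective.injOn)).mono ?_
    rintro _ ⟨p, ⟨h1, h2⟩, rfl⟩
    exact hroot p h1 h2
  refine ⟨A /ₘ B, fun p hp => ?_⟩
  have h3 : A.eval (p : ℤ) = B.eval (p : ℤ) * (A /ₘ B).eval (p : ℤ) := by
    conv_lhs => rw [← modByMonic_add_div A B, hR]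
    simp
  have := h p hp
  rw [h3, mul_comm] at this
  exact mul_left_cancel₀ (h0 p hp) this

theorem exp_lt {r : ℕ} (β : Fin r → ℕ) (hβ : ∀ i, 0 < β i) (hm : Monotone β) (j : Fin r) :
    (j : ℕ) + ∑ i, min (β j) (β i - 1) < ∑ i, min (β j) (β i) := by
  have h1 : ∑ i : Fin r, (min (β j) (β i - 1) + if i ≤ j then 1 else 0) ≤ ∑ i, min (β j) (β i) := by
    refine Finset.sum_le_sum fun i _ => ?_
    split_ifs with h
    · have := hm h
      have := hβ i
      omega
    · omega
  rw [Finset.sum_add_distrib] at h1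
  have h2 : ∑ i : Fin r, (if i ≤ j then 1 else 0) = (j : ℕ) + 1 := by
    rw [← Finset.card_filter]
    rw [show Finset.univ.filter (fun i : Fin r => i ≤ j) = Finset.Iic j by ext; simp]
    simp
  omega

open Polynomial in
theorem main_pos (n r : ℕ) (h : r ≤ n) (β : Fin r → ℕ) (hβ : ∀ i, 0 < β i) (hm : Monotone β) :
    ∃ g : ℤ[X], ∀ p : ℕ, p.Prime →
      (Nat.card {L : Submodule ℤ (Fin n → ℤ) //
        Nonempty (((Fin n → ℤ) ⧸ L) ≃+ ((i : Fin r) → ZMod (p ^ β i)))} : ℤ) = g.eval (p : ℤ) := by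
  let A : ℤ[X] := X ^ ((∑ i, (β i - 1)) * n) * ∏ i : Fin r, (X ^ n - X ^ (i : ℕ))
  let B : ℤ[X] := ∏ j : Fin r, (X ^ (∑ i, min (β j) (β i)) -
      X ^ ((j : ℕ) + ∑ i, min (β j) (β i - 1)))
  have eB : ∀ p : ℕ, p.Prime → B.eval (p : ℤ) = (Nat.card
      (((i : Fin r) → ZMod (p ^ β i)) ≃+ ((i : Fin r) → ZMod (p ^ β i))) : ℤ) := by
    intro p hp
    have := Fact.mk hp
    rw [card_aut β hβ hm]
    simp [B, eval_prod]
  refine poly_quot A B ?_ _ ?_ ?_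
  · refine monic_prod_of_monic _ _ fun j _ => ?_
    apply monic_X_pow_sub
    rw [degree_X_pow]
    exact_mod_cast exp_lt β hβ hm j
  · intro p hp
    have := Fact.mk hp
    rw [eB p hp, ← Nat.cast_mul, card_mul_aut, card_surj β hβ n h]
    simp [A, eval_prod]
  · intro p hp
    have := Fact.mk hp
    rw [eB p hp, Nat.cast_ne_zero]
    have : Finite (((i : Fin r) → ZMod (p ^ β i)) ≃+ ((i : Fin r) → ZMod (p ^ β i))) :=
      Finite.of_injective (fun e => (e : _ → _)) DFunLike.coe_injective
    exact Nat.card_pos.ne'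

end LatC

/-- For every n ≥ 1, k ≥ 0, and every partition α ∈ P(n,k), there exists an
integer polynomial g_α such that f_α(p) = g_α(p) for every prime p. -/
theorem stmt13 (n k : ℕ) (hn : 1 ≤ n) (α : Fin n → ℕ)
    (hmono : Monotone α) (hsum : ∑ i, α i = k) :
    ∃ g : Polynomial ℤ, ∀ p : ℕ, p.Prime → (latCount p α : ℤ) = g.eval (p : ℤ) := by
  classical
  let s : Finset (Fin n) := Finset.univ.filter (fun i => 0 < α i)
  let o : Fin s.card ≃o s := s.orderIsoOfFin rfl
  have hs : ∀ i, i ∈ s ↔ 0 < α i := fun i => by simp [s]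
  let β : Fin s.card → ℕ := fun j => α (o j).1
  obtain ⟨g, hg⟩ := LatC.main_pos n s.card (by simpa using s.card_le_univ) β
    (fun i => (hs _).1 (o i).2) (fun i j h => hmono (o.monotone h))
  refine ⟨g, fun p hp => ?_⟩
  rw [← hg p hp, latCount]
  let F : ((i : Fin n) → ZMod (p ^ α i)) →+ ((j : Fin s.card) → ZMod (p ^ β j)) :=
    { toFun := fun x j => x (o j).1
      map_zero' := rfl
      map_add' := fun _ _ => rfl }
  have hF : Function.Bijective F := by
    constructor
    · intro x y hxy
      funext i
      by_cases hi : 0 < α i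
      · have := congrFun hxy (o.symm ⟨i, (hs i).2 hi⟩)
        have e : (o (o.symm ⟨i, (hs i).2 hi⟩)).1 = i := by simp
        change x (o (o.symm ⟨i, (hs i).2 hi⟩)).1 = y (o (o.symm ⟨i, (hs i).2 hi⟩)).1 at this
        rwa [e] at this
      · have : Subsingleton (ZMod (p ^ α i)) := by
          rw [show α i = 0 by omega, pow_zero]; infer_instance
        exact Subsingleton.elim _ _
    · intro y
      let x : (i : Fin n) → ZMod (p ^ α i) := fun i =>
        if hi : 0 < α i then (ZMod.cast (y (o.symm ⟨i, (hs i).2 hi⟩)) : ZMod (p ^ α i)) else 0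
      refine ⟨x, ?_⟩
      funext j
      change x (o j).1 = y j
      have hj : 0 < α (o j).1 := (hs _).1 (o j).2
      simp only [x, dif_pos hj]
      have e : o.symm ⟨(o j).1, (hs _).2 hj⟩ = j := by simp
      rw [e]
      exact ZMod.cast_id _ _
  let E := AddEquiv.ofBijective F hF
  congr 1
  refine Nat.card_congr (Equiv.subtypeEquivRight fun L => ?_)
  exact ⟨fun ⟨e⟩ => ⟨e.trans E⟩, fun ⟨e⟩ => ⟨e.trans E.symm⟩⟩
end

section
/- Let n ≥ 1 and let m ≥ 1 be an integer. The number of sublattices Λ of ℤ^n such that ℤ^n/Λ is a cyclic group of order m equals (m/rad(m))^{n−1} · σ₁(rad(m)^{n−1}), where rad(m) is the product of the distinct primes dividing m (the radical of m, with rad(1) = 1) and σ₁(k) denotes the sum of all positive divisors of k. -/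
/-- rad(m): the radical of m, the product of the distinct primes dividing m (rad 1 = 1). -/
def radNat (m : ℕ) : ℕ := ∏ q ∈ m.primeFactors, q

/-- σ₁(k): the sum of all positive divisors of k. -/
def sigmaOne (k : ℕ) : ℕ := ∑ d ∈ k.divisors, d

section helpers

theorem radNat_mul_of_coprime {a b : ℕ} (h : a.Coprime b) :
    radNat (a * b) = radNat a * radNat b := by
  unfold radNat
  rw [h.primeFactors_mul, Finset.prod_union h.disjoint_primeFactors]

theorem radNat_dvd (a : ℕ) : radNat a ∣ a := Nat.prod_primeFactors_dvd a

theorem radNat_prime_pow {p : ℕ} (hp : p.Prime) (j : ℕ) : radNat (p ^ (j + 1)) = p := by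
  unfold radNat
  rw [Nat.primeFactors_prime_pow (by omega) hp]
  simp

theorem sigmaOne_eq (k : ℕ) : sigmaOne k = ArithmeticFunction.sigma 1 k := by
  simp [sigmaOne, ArithmeticFunction.sigma_one_apply]

/-- The totient times the claimed count, as an arithmetic function. -/
def helperF (k : ℕ) : ArithmeticFunction ℕ where
  toFun m := Nat.totient m * ((m / radNat m) ^ k * sigmaOne (radNat m ^ k))
  map_zero' := by simp

theorem helperF_apply (k m : ℕ) :
    helperF k m = Nat.totient m * ((m / radNat m) ^ k * sigmaOne (radNat m ^ k)) := rfl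

theorem helperF_mult (k : ℕ) : (helperF k).IsMultiplicative := by
  refine ⟨?_, ?_⟩
  · simp [helperF_apply, radNat, sigmaOne]
  · intro a b h
    have h2 : (radNat a).Coprime (radNat b) :=
      Nat.Coprime.of_dvd (radNat_dvd a) (radNat_dvd b) h
    simp only [helperF_apply, radNat_mul_of_coprime h, Nat.totient_mul h, sigmaOne_eq, mul_pow]
    rw [ArithmeticFunction.isMultiplicative_sigma.map_mul_of_coprime (h2.pow k k),
      ← Nat.div_mul_div_comm (radNat_dvd a) (radNat_dvd b), mul_pow]
    ring

theorem helperF_prime_pow (k : ℕ) {p : ℕ} (hp : p.Prime) (j : ℕ) :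
    helperF k (p ^ (j + 1)) + p ^ (j * (k + 1)) = p ^ ((j + 1) * (k + 1)) := by
  rw [helperF_apply, radNat_prime_pow hp, Nat.totient_prime_pow_succ hp, pow_succ,
    Nat.mul_div_cancel _ hp.pos, sigmaOne, Nat.sum_divisors_prime_pow hp]
  have h := Nat.geomSum_eq hp.two_le (k + 1)
  have h3 : (p - 1) * ∑ i ∈ Finset.range (k + 1), p ^ i + 1 = p ^ (k + 1) := by
    have := Nat.geomSum_eq hp.two_le (k + 1)
    zify [hp.one_le]
    rw [mul_geom_sum]; ring
  calc _ = p ^ (j * (k + 1)) * ((p - 1) * ∑ i ∈ Finset.range (k + 1), p ^ i + 1) := by ring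
    _ = _ := by rw [h3]; ring

theorem helperF_sum_prime_pow (k : ℕ) {p : ℕ} (hp : p.Prime) (j : ℕ) :
    ∑ i ∈ Finset.range (j + 1), helperF k (p ^ i) = p ^ (j * (k + 1)) := by
  induction j with
  | zero => simp [(helperF_mult k).map_one]
  | succ j ih =>
    rw [Finset.sum_range_succ, ih, ← helperF_prime_pow k hp j]; ring

theorem helperF_sum (k m : ℕ) (hm : m ≠ 0) :
    ∑ d ∈ m.divisors, helperF k d = m ^ (k + 1) := by
  have h1 : (helperF k * (ArithmeticFunction.zeta : ArithmeticFunction ℕ)) =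
      ArithmeticFunction.pow (k + 1) := by
    refine (ArithmeticFunction.IsMultiplicative.eq_iff_eq_on_prime_powers _
      ((helperF_mult k).mul ArithmeticFunction.isMultiplicative_zeta) _
      (ArithmeticFunction.isMultiplicative_pow)).2 ?_
    intro p i hp
    rw [ArithmeticFunction.mul_zeta_apply, Nat.sum_divisors_prime_pow hp,
      helperF_sum_prime_pow k hp]
    simp [ArithmeticFunction.pow_apply, pow_mul]
  have h2 := congrArg (fun g => g m) h1
  simp only [ArithmeticFunction.mul_zeta_apply] at h2
  rw [h2]
  simp [ArithmeticFunction.pow_apply]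

/-- Sublattices with cyclic quotient of order d. -/
abbrev CocycLat (n d : ℕ) := {Λ : Submodule ℤ (Fin n → ℤ) //
        IsAddCyclic ((Fin n → ℤ) ⧸ Λ) ∧ Nat.card ((Fin n → ℤ) ⧸ Λ) = d}

theorem ker_props {n m : ℕ} [NeZero m] (f : (Fin n → ℤ) →ₗ[ℤ] ZMod m) :
    IsAddCyclic ((Fin n → ℤ) ⧸ LinearMap.ker f) ∧
      Nat.card ((Fin n → ℤ) ⧸ LinearMap.ker f) ∣ m := by
  have e := f.quotKerEquivRange
  constructor
  · have : IsAddCyclic (LinearMap.range f) :=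
      inferInstanceAs (IsAddCyclic (LinearMap.range f).toAddSubgroup)
    exact isAddCyclic_of_surjective e.symm.toAddEquiv e.symm.surjective
  · rw [Nat.card_congr e.toEquiv]
    have := AddSubgroup.card_addSubgroup_dvd_card (LinearMap.range f).toAddSubgroup
    rw [Nat.card_zmod] at this
    exact this

theorem fiber_card {n m d : ℕ} [NeZero m] (hd : d ∣ m) (Λ : CocycLat n d) :
    Nonempty ({f : (Fin n → ℤ) →ₗ[ℤ] ZMod m // LinearMap.ker f = Λ.1} ≃
      {x : ZMod m // addOrderOf x = d}) := by
  obtain ⟨Λ, hc, hcard⟩ := Λ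
  have hd0 : d ≠ 0 := fun h => NeZero.ne m (by subst h; simpa using hd)
  -- an isomorphism with ZMod d
  have : IsAddCyclic ((Fin n → ℤ) ⧸ Λ) := hc
  let e : ((Fin n → ℤ) ⧸ Λ) ≃+ ZMod d :=
    addEquivOfAddCyclicCardEq (by rw [hcard, Nat.card_zmod])
  obtain ⟨g, hg⟩ := Λ.mkQ_surjective (e.symm 1)
  have key : ∀ v, ∃ z : ℤ, v - z • g ∈ Λ := by
    intro v
    obtain ⟨z, hz⟩ := ZMod.intCast_surjective (e (Λ.mkQ v))
    refine ⟨z, ?_⟩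
    rw [← Submodule.Quotient.mk_eq_zero, ← Submodule.mkQ_apply]
    apply e.injective
    rw [map_sub, map_zsmul, hg, map_sub, map_zsmul, ← hz]
    simp
  have keyg : ∀ z : ℤ, z • g ∈ Λ ↔ (d : ℤ) ∣ z := by
    intro z
    rw [← Submodule.Quotient.mk_eq_zero, ← Submodule.mkQ_apply, map_zsmul, hg,
      ← e.injective.eq_iff, map_zsmul, ← ZMod.intCast_zmod_eq_zero_iff_dvd]
    · simp
  refine ⟨Equiv.ofBijective (fun f => ⟨f.1 g, ?_⟩) ⟨?_, ?_⟩⟩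
  · obtain ⟨f, hf⟩ := f
    simp only at hf ⊢
    apply Nat.dvd_antisymm
    · rw [addOrderOf_dvd_iff_nsmul_eq_zero]
      have := (keyg d).2 dvd_rfl
      rw [← hf, LinearMap.mem_ker, map_zsmul] at this
      simpa using this
    · have : ((addOrderOf (f g) : ℕ) : ℤ) • g ∈ Λ := by
        rw [← hf, LinearMap.mem_ker, map_zsmul, natCast_zsmul, addOrderOf_nsmul_eq_zero]
      exact_mod_cast (keyg _).1 this
  · rintro ⟨f, hf⟩ ⟨f', hf'⟩ h
    simp only [Subtype.mk.injEq] at h hf hf' ⊢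
    refine LinearMap.ext fun v => ?_
    obtain ⟨z, hz⟩ := key v
    have h1 := hz
    have h2 := hz
    rw [← hf, LinearMap.mem_ker, map_sub, map_zsmul, sub_eq_zero] at h1
    rw [← hf', LinearMap.mem_ker, map_sub, map_zsmul, sub_eq_zero] at h2
    rw [h1, h2, h]
  · rintro ⟨x, hx⟩
    let l : ZMod d →+ ZMod m := ZMod.lift d ⟨zmultiplesHom _ x, by
      rw [zmultiplesHom_apply, natCast_zsmul, ← hx, addOrderOf_nsmul_eq_zero]⟩
    have hl : ∀ z : ℤ, l z = z • x := fun z => by simp [l]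
    let f : (Fin n → ℤ) →ₗ[ℤ] ZMod m :=
      ((l.comp e.toAddMonoidHom).toIntLinearMap).comp Λ.mkQ
    have hfv : ∀ v, f v = l (e (Λ.mkQ v)) := fun v => rfl
    refine ⟨⟨f, ?_⟩, ?_⟩
    · ext v
      rw [LinearMap.mem_ker, hfv]
      obtain ⟨z, hz⟩ := ZMod.intCast_surjective (e (Λ.mkQ v))
      rw [← hz, hl, ← addOrderOf_dvd_iff_zsmul_eq_zero, hx, ← ZMod.intCast_zmod_eq_zero_iff_dvd,
        hz, ← Submodule.Quotient.mk_eq_zero, ← Submodule.mkQ_apply]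
      simp
    · apply Subtype.ext
      change f g = x
      rw [hfv, hg]
      simpa using hl 1

theorem fiber_total {n m d : ℕ} [NeZero m] (hd : d ∣ m) :
    Nat.card {f : (Fin n → ℤ) →ₗ[ℤ] ZMod m //
      Nat.card ((Fin n → ℤ) ⧸ LinearMap.ker f) = d} = Nat.card (CocycLat n d) * Nat.totient d := by
  let F : {f : (Fin n → ℤ) →ₗ[ℤ] ZMod m //
      Nat.card ((Fin n → ℤ) ⧸ LinearMap.ker f) = d} → CocycLat n d :=
    fun f => ⟨LinearMap.ker f.1, (ker_props f.1).1, f.2⟩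
  have e2 : ∀ Λ : CocycLat n d, {f // F f = Λ} ≃ {x : ZMod m // addOrderOf x = d} := fun Λ =>
    Equiv.trans
      { toFun := fun f => ⟨f.1.1, congrArg Subtype.val f.2⟩
        invFun := fun f => ⟨⟨f.1, by rw [f.2]; exact Λ.2.2⟩, Subtype.ext f.2⟩
        left_inv := fun _ => rfl
        right_inv := fun _ => rfl } (fiber_card hd Λ).some
  rw [Nat.card_congr ((Equiv.sigmaFiberEquiv F).symm.trans
    ((Equiv.sigmaCongrRight e2).trans (Equiv.sigmaEquivProd _ _))), Nat.card_prod]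
  congr 1
  rw [Nat.card_eq_fintype_card, Fintype.card_subtype]
  exact IsAddCyclic.card_addOrderOf_eq_totient (by rwa [ZMod.card])

theorem lat_sum (n m : ℕ) (hm : m ≠ 0) :
    ∑ d ∈ m.divisors, Nat.card (CocycLat n d) * Nat.totient d = m ^ n := by
  classical
  have : NeZero m := ⟨hm⟩
  let e : (Fin n → ZMod m) ≃ ((Fin n → ℤ) →ₗ[ℤ] ZMod m) :=
    ((Pi.basisFun ℤ (Fin n)).constr ℤ).toEquiv
  let : Fintype ((Fin n → ℤ) →ₗ[ℤ] ZMod m) := Fintype.ofEquiv _ e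
  have hc : (Finset.univ : Finset ((Fin n → ℤ) →ₗ[ℤ] ZMod m)).card = m ^ n := by
    rw [Finset.card_univ, ← Fintype.card_congr e]; simp
  rw [← hc, Finset.card_eq_sum_card_fiberwise
    (f := fun f => Nat.card ((Fin n → ℤ) ⧸ LinearMap.ker f)) (t := m.divisors)]
  · refine Finset.sum_congr rfl fun d hd => ?_
    rw [← fiber_total (Nat.dvd_of_mem_divisors hd), Nat.card_eq_fintype_card,
      Fintype.card_subtype]
  · intro f _
    simpa [hm] using (ker_props f).2

theorem lat_eq (k : ℕ) (m : ℕ) (hm : m ≠ 0) :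
    Nat.card (CocycLat (k + 1) m) * Nat.totient m = helperF k m := by
  induction m using Nat.strong_induction_on with
  | _ m ih =>
    have h := (lat_sum (k + 1) m hm).trans (helperF_sum k m hm).symm
    rw [← Nat.cons_self_properDivisors hm, Finset.sum_cons, Finset.sum_cons,
      Finset.sum_congr rfl (fun d hd => ih d (Nat.mem_properDivisors.1 hd).2
        (Nat.pos_of_mem_properDivisors hd).ne')] at h
    exact Nat.add_right_cancel h

end helpers

/-- Let n ≥ 1 and m ≥ 1. The number of sublattices Λ of ℤ^n with ℤ^n/Λ cyclic
of order m equals (m/rad(m))^{n−1} · σ₁(rad(m)^{n−1}). -/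
theorem stmt17 (n : ℕ) (hn : 1 ≤ n) (m : ℕ) (hm : 1 ≤ m) :
    Nat.card {Λ : Submodule ℤ (Fin n → ℤ) //
        IsAddCyclic ((Fin n → ℤ) ⧸ Λ) ∧ Nat.card ((Fin n → ℤ) ⧸ Λ) = m} =
      (m / radNat m) ^ (n - 1) * sigmaOne (radNat m ^ (n - 1)) := by
  obtain ⟨k, rfl⟩ : ∃ k, n = k + 1 := ⟨n - 1, by omega⟩
  have h := lat_eq k m (by omega)
  rw [helperF_apply, mul_comm] at h
  exact Nat.eq_of_mul_eq_mul_left (Nat.totient_pos.2 hm) h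
end
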